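/- arXiv:1701.06798 — 2 statements merged into one kernel-verified Lean document; each statement's English description precedes it below -/
import Mathlib

section
/- Up to equivalence, there are exactly two fine gradings on K₃ × K₃: the ℤ²-grading Γ¹(ℤ²;(1,0),(0,1)) and the (ℤ×ℤ/2)-grading Γ²(ℤ×ℤ/2;(1,0̄),(0,1̄)). That is, each of these two gradings is fine, they are not equivalent to each other, and every fine grading on K₃ × K₃ by an abelian group is equivalent to one of them. -/
open scoped TensorProduct
noncomputable section
namespace Kac

/-! ### Superalgebra isomorphisms and automorphisms -/

@[ext]
structure SuperIso (S A B : Type) [CommRing S]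
    [AddCommGroup A] [Module S A] [Mul A]
    [AddCommGroup B] [Module S B] [Mul B]
    (evA odA : Submodule S A) (evB odB : Submodule S B) : Type where
  e : A ≃ₗ[S] B
  map_mul' : ∀ x y : A, e (x * y) = e x * e y
  map_even : evA.map e.toLinearMap = evB
  map_odd : odA.map e.toLinearMap = odB

abbrev SuperAut (S A : Type) [CommRing S] [AddCommGroup A] [Module S A] [Mul A]
    (ev od : Submodule S A) := SuperIso S A A ev od ev od

namespace SuperAut

variable {S A : Type} [CommRing S] [AddCommGroup A] [Module S A] [Mul A]
variable {ev od : Submodule S A}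

private lemma map_symm {f : A ≃ₗ[S] A} {p : Submodule S A}
    (h : p.map f.toLinearMap = p) : p.map f.symm.toLinearMap = p := by
  have h2 : f.symm.toLinearMap.comp f.toLinearMap = LinearMap.id := by
    ext x; simp
  calc p.map f.symm.toLinearMap
      = (p.map f.toLinearMap).map f.symm.toLinearMap := by rw [h]
    _ = p.map (f.symm.toLinearMap.comp f.toLinearMap) := by
        rw [Submodule.map_comp]
    _ = p := by rw [h2, Submodule.map_id]

instance : Group (SuperAut S A ev od) where
  one := ⟨LinearEquiv.refl S A, fun _ _ => rfl, Submodule.map_id _, Submodule.map_id _⟩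
  mul f g := ⟨g.e.trans f.e,
    fun x y => by simp [LinearEquiv.trans_apply, g.map_mul', f.map_mul'],
    by rw [LinearEquiv.coe_trans, Submodule.map_comp, g.map_even, f.map_even],
    by rw [LinearEquiv.coe_trans, Submodule.map_comp, g.map_odd, f.map_odd]⟩
  inv f := ⟨f.e.symm,
    fun x y => f.e.injective <| by simp [f.map_mul'],
    map_symm f.map_even, map_symm f.map_odd⟩
  mul_assoc f g h := by apply SuperIso.ext; apply LinearEquiv.ext; intro x; rfl
  one_mul f := by apply SuperIso.ext; apply LinearEquiv.ext; intro x; rfl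
  mul_one f := by apply SuperIso.ext; apply LinearEquiv.ext; intro x; rfl
  inv_mul_cancel f := by
    apply SuperIso.ext; apply LinearEquiv.ext; intro x
    exact f.e.symm_apply_apply x

end SuperAut

/-- The predicate that a pair of submodules `ev`, `od` makes a non-unital
(possibly non-associative) algebra `B` into a superalgebra. -/
def IsSuperalgebra (S B : Type) [CommRing S] [NonUnitalNonAssocRing B] [Module S B]
    (ev od : Submodule S B) : Prop :=
  ev ⊔ od = ⊤ ∧ ev ⊓ od = ⊥ ∧
  (∀ x ∈ ev, ∀ y ∈ ev, x * y ∈ ev) ∧ (∀ x ∈ ev, ∀ y ∈ od, x * y ∈ od) ∧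
  (∀ x ∈ od, ∀ y ∈ ev, x * y ∈ od) ∧ (∀ x ∈ od, ∀ y ∈ od, x * y ∈ ev)

/-! ### Submodules given by vanishing of coordinates -/

def stdSub (S R : Type) [Semiring S] [AddCommGroup R] [Module S R] (n : ℕ)
    (s : Set (Fin n)) : Submodule S (Fin n → R) where
  carrier := {x | ∀ i, i ∉ s → x i = 0}
  add_mem' := fun {a b} ha hb i hi => by
    simp [Pi.add_apply, ha i hi, hb i hi]
  zero_mem' := fun i _ => rfl
  smul_mem' := fun c x hx i hi => by
    simp [Pi.smul_apply, hx i hi]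

/-! ### Gradings by abelian groups -/

section Gradings

variable {G H S A : Type} [CommGroup G] [CommGroup H] [CommRing S]
  [AddCommGroup A] [Module S A] [Mul A]

/-- `comp` is a `G`-grading of the superalgebra `(A, ev, od)`. -/
def IsSuperGrading (ev od : Submodule S A) (comp : G → Submodule S A) : Prop :=
  (letI := Classical.decEq G; DirectSum.IsInternal comp) ∧
  (∀ (g h : G) (x y : A), x ∈ comp g → y ∈ comp h → x * y ∈ comp (g * h)) ∧
  (∀ g, comp g = (comp g ⊓ ev) ⊔ (comp g ⊓ od))

/-- The grading with homogeneous elements `w i` of degrees `d i`. -/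
def gradingOf (S : Type) {A G : Type} [CommRing S] [AddCommGroup A] [Module S A]
    [CommGroup G] {n : ℕ} (w : Fin n → A) (d : Fin n → G) : G → Submodule S A :=
  fun g => Submodule.span S (w '' {i | d i = g})

/-- Isomorphism of two `G`-gradings on a superalgebra. -/
def GradIso (ev od : Submodule S A) (comp comp' : G → Submodule S A) : Prop :=
  ∃ φ : SuperAut S A ev od, ∀ g, (comp g).map φ.e.toLinearMap = comp' g

/-- `Δ` refines `Γ`. -/
def Refines (Δ : H → Submodule S A) (Γ : G → Submodule S A) : Prop :=
  ∀ h, Δ h ≠ ⊥ → ∃ g, Δ h ≤ Γ g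

/-- Equivalence of a `G`-grading and an `H`-grading on a superalgebra. -/
def GradEquiv (ev od : Submodule S A) (Γ : G → Submodule S A)
    (Δ : H → Submodule S A) : Prop :=
  ∃ φ : SuperAut S A ev od, ∃ α : {g : G // Γ g ≠ ⊥} → {h : H // Δ h ≠ ⊥},
    Function.Bijective α ∧
    ∀ g : {g : G // Γ g ≠ ⊥}, (Γ g.1).map φ.e.toLinearMap = Δ (α g).1

/-- A grading is fine if any grading refining it has the same nonzero
homogeneous components. -/
def IsFine (ev od : Submodule S A) (Γ : G → Submodule S A) : Prop :=
  ∀ (H : Type) (_ : CommGroup H) (Δ : H → Submodule S A),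
    IsSuperGrading ev od Δ → Refines Δ Γ →
      {p : Submodule S A | p ≠ ⊥ ∧ ∃ h, Δ h = p} =
      {p : Submodule S A | p ≠ ⊥ ∧ ∃ g, Γ g = p}

end Gradings

/-! ### SL₂ and the semidirect product with C₂ -/

abbrev SL2 (R : Type) [CommRing R] := Matrix.SpecialLinearGroup (Fin 2) R

def swapAut (M : Type) [Monoid M] : MulAut (M × M) := MulEquiv.prodComm

lemma swapAut_sq (M : Type) [Monoid M] : swapAut M * swapAut M = 1 :=
  MulEquiv.ext fun _ => rfl

/-- The action of `C₂ = Multiplicative (ZMod 2)` on `M × M` by swapping the factors. -/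
def swapHom (M : Type) [Group M] : Multiplicative (ZMod 2) →* MulAut (M × M) :=
  MonoidHom.mk' (fun c => if c.toAdd = 0 then 1 else swapAut M) (by
    intro a b
    have key : ∀ c : Multiplicative (ZMod 2),
        c = Multiplicative.ofAdd 0 ∨ c = Multiplicative.ofAdd 1 := by decide
    rcases key a with rfl | rfl <;> rcases key b with rfl | rfl <;>
      simp [← ofAdd_add, swapAut_sq] <;> exact fun h => absurd (by decide) h)

end Kac
/-! ### The (base-changed) Kaplansky superalgebra `K₃ ⊗ R` -/

namespace Kac

section Algebras

variable (F : Type) [Field F] (R : Type) [CommRing R] [Algebra F R]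

/-- Coordinates: `0 ↦ a`, `1 ↦ u`, `2 ↦ v`. -/
def K3A (F : Type) [Field F] (R : Type) [CommRing R] [Algebra F R] : Type := Fin 3 → R

instance : AddCommGroup (K3A F R) := Pi.addCommGroup
instance (S : Type) [Semiring S] [Module S R] : Module S (K3A F R) := Pi.module _ _ _

namespace K3A
variable {F R}

def mulFun (x y : K3A F R) : K3A F R := fun i =>
  match i with
  | ⟨0, _⟩ => x 0 * y 0 + (x 1 * y 2 - x 2 * y 1)
  | ⟨1, _⟩ => algebraMap F R 2⁻¹ * (x 0 * y 1 + y 0 * x 1)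
  | ⟨2, _⟩ => algebraMap F R 2⁻¹ * (x 0 * y 2 + y 0 * x 2)

instance : Mul (K3A F R) := ⟨mulFun⟩

lemma mul_def (x y : K3A F R) : x * y = mulFun x y := rfl

@[simp] lemma add_apply (x y : K3A F R) (i : Fin 3) : (x + y) i = x i + y i := rfl
@[simp] lemma sub_apply (x y : K3A F R) (i : Fin 3) : (x - y) i = x i - y i := rfl
@[simp] lemma neg_apply (x : K3A F R) (i : Fin 3) : (-x) i = -(x i) := rfl
@[simp] lemma zero_apply (i : Fin 3) : (0 : K3A F R) i = 0 := rfl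
@[simp] lemma smul_apply (S : Type) [Semiring S] [Module S R] (c : S) (x : K3A F R) (i : Fin 3) :
    (c • x) i = c • (x i) := rfl

variable (F R)

/-- The even part `R·a`. -/
def even (S : Type) [Semiring S] [Module S R] : Submodule S (K3A F R) := stdSub S R 3 {0}
/-- The odd part `W ⊗ R`. -/
def odd (S : Type) [Semiring S] [Module S R] : Submodule S (K3A F R) := stdSub S R 3 {1, 2}

/-- The element `a`. -/
def aE : K3A F R := ![1, 0, 0]
/-- The element of `W ⊗ R` with coordinates `w` in the symplectic basis `{u, v}`. -/
def wE (w : Fin 2 → R) : K3A F R := ![0, w 0, w 1]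

end K3A

/-- `J(W) ⊗ R`; coordinates: `0 ↦ 1`, `1 ↦ u`, `2 ↦ v`. -/
def JW1A (R : Type) [CommRing R] : Type := Fin 3 → R

instance : AddCommGroup (JW1A R) := Pi.addCommGroup
instance (S : Type) [Semiring S] [Module S R] : Module S (JW1A R) := Pi.module _ _ _

namespace JW1A
variable {R}

def mulFun (x y : JW1A R) : JW1A R := fun i =>
  match i with
  | ⟨0, _⟩ => x 0 * y 0 + (x 1 * y 2 - x 2 * y 1)
  | ⟨1, _⟩ => x 0 * y 1 + y 0 * x 1
  | ⟨2, _⟩ => x 0 * y 2 + y 0 * x 2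

instance : Mul (JW1A R) := ⟨mulFun⟩

lemma mul_def (x y : JW1A R) : x * y = mulFun x y := rfl

@[simp] lemma add_apply (x y : JW1A R) (i : Fin 3) : (x + y) i = x i + y i := rfl
@[simp] lemma sub_apply (x y : JW1A R) (i : Fin 3) : (x - y) i = x i - y i := rfl
@[simp] lemma neg_apply (x : JW1A R) (i : Fin 3) : (-x) i = -(x i) := rfl
@[simp] lemma zero_apply (i : Fin 3) : (0 : JW1A R) i = 0 := rfl
@[simp] lemma smul_apply (S : Type) [Semiring S] [Module S R] (c : S) (x : JW1A R) (i : Fin 3) :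
    (c • x) i = c • (x i) := rfl

variable (R)

def even (S : Type) [Semiring S] [Module S R] : Submodule S (JW1A R) := stdSub S R 3 {0}
def odd (S : Type) [Semiring S] [Module S R] : Submodule S (JW1A R) := stdSub S R 3 {1, 2}

def oneE : JW1A R := ![1, 0, 0]
def wE (w : Fin 2 → R) : JW1A R := ![0, w 0, w 1]

end JW1A

/-- `(K₃ × K₃) ⊗ R`; coordinates `0,1,2` for the first copy (`a,u,v`),
`3,4,5` for the second copy. -/
def K33A (F : Type) [Field F] (R : Type) [CommRing R] [Algebra F R] : Type := Fin 6 → R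

instance : AddCommGroup (K33A F R) := Pi.addCommGroup
instance (S : Type) [Semiring S] [Module S R] : Module S (K33A F R) := Pi.module _ _ _

namespace K33A
variable {F R}

def mulFun (x y : K33A F R) : K33A F R := fun i =>
  match i with
  | ⟨0, _⟩ => x 0 * y 0 + (x 1 * y 2 - x 2 * y 1)
  | ⟨1, _⟩ => algebraMap F R 2⁻¹ * (x 0 * y 1 + y 0 * x 1)
  | ⟨2, _⟩ => algebraMap F R 2⁻¹ * (x 0 * y 2 + y 0 * x 2)
  | ⟨3, _⟩ => x 3 * y 3 + (x 4 * y 5 - x 5 * y 4)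
  | ⟨4, _⟩ => algebraMap F R 2⁻¹ * (x 3 * y 4 + y 3 * x 4)
  | ⟨5, _⟩ => algebraMap F R 2⁻¹ * (x 3 * y 5 + y 3 * x 5)

instance : Mul (K33A F R) := ⟨mulFun⟩

lemma mul_def (x y : K33A F R) : x * y = mulFun x y := rfl

@[simp] lemma add_apply (x y : K33A F R) (i : Fin 6) : (x + y) i = x i + y i := rfl
@[simp] lemma sub_apply (x y : K33A F R) (i : Fin 6) : (x - y) i = x i - y i := rfl
@[simp] lemma neg_apply (x : K33A F R) (i : Fin 6) : (-x) i = -(x i) := rfl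
@[simp] lemma zero_apply (i : Fin 6) : (0 : K33A F R) i = 0 := rfl
@[simp] lemma smul_apply (S : Type) [Semiring S] [Module S R] (c : S) (x : K33A F R) (i : Fin 6) :
    (c • x) i = c • (x i) := rfl

variable (F R)

def even (S : Type) [Semiring S] [Module S R] : Submodule S (K33A F R) := stdSub S R 6 {0, 3}
def odd (S : Type) [Semiring S] [Module S R] : Submodule S (K33A F R) := stdSub S R 6 {1, 2, 4, 5}

/-- The element `(a, 0)`. -/
def aLeft : K33A F R := ![1, 0, 0, 0, 0, 0]
/-- The element `(0, a)`. -/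
def aRight : K33A F R := ![0, 0, 0, 1, 0, 0]
/-- The element `(v, w)` of the odd part, `v, w ∈ W ⊗ R`. -/
def oddE (w w' : Fin 2 → R) : K33A F R := ![0, w 0, w 1, 0, w' 0, w' 1]
/-- The exchange automorphism `(x, y) ↦ (y, x)`. -/
def swapFun (x : K33A F R) : K33A F R := fun i =>
  match i with
  | ⟨0, _⟩ => x 3
  | ⟨1, _⟩ => x 4
  | ⟨2, _⟩ => x 5
  | ⟨3, _⟩ => x 0
  | ⟨4, _⟩ => x 1
  | ⟨5, _⟩ => x 2

end K33A

/-- `(J(W) × J(W)) ⊗ R`. -/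
def JW2A (R : Type) [CommRing R] : Type := Fin 6 → R

instance : AddCommGroup (JW2A R) := Pi.addCommGroup
instance (S : Type) [Semiring S] [Module S R] : Module S (JW2A R) := Pi.module _ _ _

namespace JW2A
variable {R}

def mulFun (x y : JW2A R) : JW2A R := fun i =>
  match i with
  | ⟨0, _⟩ => x 0 * y 0 + (x 1 * y 2 - x 2 * y 1)
  | ⟨1, _⟩ => x 0 * y 1 + y 0 * x 1
  | ⟨2, _⟩ => x 0 * y 2 + y 0 * x 2
  | ⟨3, _⟩ => x 3 * y 3 + (x 4 * y 5 - x 5 * y 4)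
  | ⟨4, _⟩ => x 3 * y 4 + y 3 * x 4
  | ⟨5, _⟩ => x 3 * y 5 + y 3 * x 5

instance : Mul (JW2A R) := ⟨mulFun⟩

lemma mul_def (x y : JW2A R) : x * y = mulFun x y := rfl

@[simp] lemma add_apply (x y : JW2A R) (i : Fin 6) : (x + y) i = x i + y i := rfl
@[simp] lemma sub_apply (x y : JW2A R) (i : Fin 6) : (x - y) i = x i - y i := rfl
@[simp] lemma neg_apply (x : JW2A R) (i : Fin 6) : (-x) i = -(x i) := rfl
@[simp] lemma zero_apply (i : Fin 6) : (0 : JW2A R) i = 0 := rfl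
@[simp] lemma smul_apply (S : Type) [Semiring S] [Module S R] (c : S) (x : JW2A R) (i : Fin 6) :
    (c • x) i = c • (x i) := rfl

variable (R)

def even (S : Type) [Semiring S] [Module S R] : Submodule S (JW2A R) := stdSub S R 6 {0, 3}
def odd (S : Type) [Semiring S] [Module S R] : Submodule S (JW2A R) := stdSub S R 6 {1, 2, 4, 5}

/-- The element `(1, 0)`. -/
def oneLeft : JW2A R := ![1, 0, 0, 0, 0, 0]
/-- The element `(0, 1)`. -/
def oneRight : JW2A R := ![0, 0, 0, 1, 0, 0]
def oddE (w w' : Fin 2 → R) : JW2A R := ![0, w 0, w 1, 0, w' 0, w' 1]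
def swapFun (x : JW2A R) : JW2A R := fun i =>
  match i with
  | ⟨0, _⟩ => x 3
  | ⟨1, _⟩ => x 4
  | ⟨2, _⟩ => x 5
  | ⟨3, _⟩ => x 0
  | ⟨4, _⟩ => x 1
  | ⟨5, _⟩ => x 2

end JW2A

/-- Kac's superalgebra `K₁₀ ⊗ R`.  CoordinatesL `0 ↦ 1`, `1 ↦ a⊗a`,
`2 ↦ u⊗u`, `3 ↦ u⊗v`, `4 ↦ v⊗u`, `5 ↦ v⊗v`, `6 ↦ u⊗a`, `7 ↦ v⊗a`,
`8 ↦ a⊗u`, `9 ↦ a⊗v`. -/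
def K10A (F : Type) [Field F] (R : Type) [CommRing R] [Algebra F R] : Type := Fin 10 → R

instance : AddCommGroup (K10A F R) := Pi.addCommGroup
instance (S : Type) [Semiring S] [Module S R] : Module S (K10A F R) := Pi.module _ _ _

namespace K10A
variable {F R}

def mulFun (x y : K10A F R) : K10A F R := fun i =>
  match i with
  | ⟨0, _⟩ => x 0 * y 0 - algebraMap F R (3/16) * (x 1 * y 1)
      + algebraMap F R (3/4) * (x 2 * y 5 + x 5 * y 2 - x 3 * y 4 - x 4 * y 3)
      - algebraMap F R (3/8) * (x 6 * y 7 - x 7 * y 6 + x 8 * y 9 - x 9 * y 8)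
  | ⟨1, _⟩ => x 0 * y 1 + x 1 * y 0 + x 1 * y 1
      - (x 2 * y 5 + x 5 * y 2 - x 3 * y 4 - x 4 * y 3)
      + (x 6 * y 7 - x 7 * y 6) + (x 8 * y 9 - x 9 * y 8)
  | ⟨2, _⟩ => x 0 * y 2 + x 2 * y 0 + algebraMap F R 4⁻¹ * (x 1 * y 2 + x 2 * y 1)
      + algebraMap F R 4⁻¹ * (x 6 * y 8 - x 8 * y 6)
  | ⟨3, _⟩ => x 0 * y 3 + x 3 * y 0 + algebraMap F R 4⁻¹ * (x 1 * y 3 + x 3 * y 1)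
      + algebraMap F R 4⁻¹ * (x 6 * y 9 - x 9 * y 6)
  | ⟨4, _⟩ => x 0 * y 4 + x 4 * y 0 + algebraMap F R 4⁻¹ * (x 1 * y 4 + x 4 * y 1)
      + algebraMap F R 4⁻¹ * (x 7 * y 8 - x 8 * y 7)
  | ⟨5, _⟩ => x 0 * y 5 + x 5 * y 0 + algebraMap F R 4⁻¹ * (x 1 * y 5 + x 5 * y 1)
      + algebraMap F R 4⁻¹ * (x 7 * y 9 - x 9 * y 7)
  | ⟨6, _⟩ => x 0 * y 6 + x 6 * y 0 + algebraMap F R 2⁻¹ * (x 1 * y 6 + x 6 * y 1)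
      + algebraMap F R 2⁻¹ * (x 2 * y 9 + x 9 * y 2) - algebraMap F R 2⁻¹ * (x 3 * y 8 + x 8 * y 3)
  | ⟨7, _⟩ => x 0 * y 7 + x 7 * y 0 + algebraMap F R 2⁻¹ * (x 1 * y 7 + x 7 * y 1)
      + algebraMap F R 2⁻¹ * (x 4 * y 9 + x 9 * y 4) - algebraMap F R 2⁻¹ * (x 5 * y 8 + x 8 * y 5)
  | ⟨8, _⟩ => x 0 * y 8 + x 8 * y 0 + algebraMap F R 2⁻¹ * (x 1 * y 8 + x 8 * y 1)
      - algebraMap F R 2⁻¹ * (x 2 * y 7 + x 7 * y 2) + algebraMap F R 2⁻¹ * (x 4 * y 6 + x 6 * y 4)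
  | ⟨9, _⟩ => x 0 * y 9 + x 9 * y 0 + algebraMap F R 2⁻¹ * (x 1 * y 9 + x 9 * y 1)
      - algebraMap F R 2⁻¹ * (x 3 * y 7 + x 7 * y 3) + algebraMap F R 2⁻¹ * (x 5 * y 6 + x 6 * y 5)

instance : Mul (K10A F R) := ⟨mulFun⟩

lemma mul_def (x y : K10A F R) : x * y = mulFun x y := rfl

@[simp] lemma add_apply (x y : K10A F R) (i : Fin 10) : (x + y) i = x i + y i := rfl
@[simp] lemma sub_apply (x y : K10A F R) (i : Fin 10) : (x - y) i = x i - y i := rfl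
@[simp] lemma neg_apply (x : K10A F R) (i : Fin 10) : (-x) i = -(x i) := rfl
@[simp] lemma zero_apply (i : Fin 10) : (0 : K10A F R) i = 0 := rfl
@[simp] lemma smul_apply (S : Type) [Semiring S] [Module S R] (c : S) (x : K10A F R) (i : Fin 10) :
    (c • x) i = c • (x i) := rfl

variable (F R)

def even (S : Type) [Semiring S] [Module S R] : Submodule S (K10A F R) :=
  stdSub S R 10 {0, 1, 2, 3, 4, 5}
def odd (S : Type) [Semiring S] [Module S R] : Submodule S (K10A F R) :=
  stdSub S R 10 {6, 7, 8, 9}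

/-- The unity `1`. -/
def oneE : K10A F R := ![1, 0, 0, 0, 0, 0, 0, 0, 0, 0]
/-- The element `a ⊗ a`. -/
def aaE : K10A F R := ![0, 1, 0, 0, 0, 0, 0, 0, 0, 0]
/-- The element `v ⊗ w ∈ W ⊗ W`. -/
def wwE (w w' : Fin 2 → R) : K10A F R :=
  ![0, 0, w 0 * w' 0, w 0 * w' 1, w 1 * w' 0, w 1 * w' 1, 0, 0, 0, 0]
/-- The element `w ⊗ a`, `w ∈ W ⊗ R`. -/
def waE (w : Fin 2 → R) : K10A F R := ![0, 0, 0, 0, 0, 0, w 0, w 1, 0, 0]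
/-- The element `a ⊗ w`, `w ∈ W ⊗ R`. -/
def awE (w : Fin 2 → R) : K10A F R := ![0, 0, 0, 0, 0, 0, 0, 0, w 0, w 1]
/-- The exchange automorphism `τ`, `τ(x ⊗ y) = (-1)^{|x||y|} y ⊗ x`. -/
def tauFun (x : K10A F R) : K10A F R := fun i =>
  match i with
  | ⟨0, _⟩ => x 0
  | ⟨1, _⟩ => x 1
  | ⟨2, _⟩ => -x 2
  | ⟨3, _⟩ => -x 4
  | ⟨4, _⟩ => -x 3
  | ⟨5, _⟩ => -x 5
  | ⟨6, _⟩ => x 8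
  | ⟨7, _⟩ => x 9
  | ⟨8, _⟩ => x 6
  | ⟨9, _⟩ => x 7

end K10A

end Algebras

end Kac

namespace Kac

section GradingDefs

variable (F : Type) [Field F] {G : Type} [CommGroup G]

/-- Standard basis of `K₃ × K₃` (`a₁, u₁, v₁, a₂, u₂, v₂`). -/
def K33A.bv (i : Fin 6) : K33A F F := Pi.single i 1

/-- The grading `Γ¹(G; g₁, g₂)` on `K₃ × K₃`: all even elements have degree
`e`, `deg (u,0) = g₁ = deg (v,0)⁻¹`, `deg (0,u) = g₂ = deg (0,v)⁻¹`. -/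
def K33A.gamma1 (g1 g2 : G) : G → Submodule F (K33A F F) :=
  gradingOf F (K33A.bv F) ![1, g1, g1⁻¹, 1, g2, g2⁻¹]

/-- The grading `Γ²(G; g, h)` on `K₃ × K₃` (`h² = e ≠ h`):
`deg (a,a) = e`, `deg (a,-a) = h`, `deg (u,u) = g = deg (v,v)⁻¹`,
`deg (u,-u) = gh = deg (v,-v)⁻¹`. -/
def K33A.gamma2 (g h : G) : G → Submodule F (K33A F F) :=
  gradingOf F
    ![K33A.bv F 0 + K33A.bv F 3, K33A.bv F 0 - K33A.bv F 3,
      K33A.bv F 1 + K33A.bv F 4, K33A.bv F 2 + K33A.bv F 5,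
      K33A.bv F 1 - K33A.bv F 4, K33A.bv F 2 - K33A.bv F 5]
    ![1, h, g, g⁻¹, g * h, g⁻¹ * h]

/-- Standard (homogeneous) basis of `K₁₀`:
`1, a⊗a, u⊗u, u⊗v, v⊗u, v⊗v, u⊗a, v⊗a, a⊗u, a⊗v`. -/
def K10A.bv (i : Fin 10) : K10A F F := Pi.single i 1

/-- The grading `Γ¹_{K₁₀}(G; g₁, g₂)` on `K₁₀`, determined by
`deg (u⊗a) = g₁ = deg (v⊗a)⁻¹`, `deg (a⊗u) = g₂ = deg (a⊗v)⁻¹`. -/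
def K10A.gamma1 (g1 g2 : G) : G → Submodule F (K10A F F) :=
  gradingOf F (K10A.bv F)
    ![1, 1, g1 * g2, g1 * g2⁻¹, g1⁻¹ * g2, g1⁻¹ * g2⁻¹, g1, g1⁻¹, g2, g2⁻¹]

/-- The grading `Γ²_{K₁₀}(G; g, h)` on `K₁₀` (`h² = e ≠ h`), determined by
`deg (u⊗a + a⊗u) = g = deg (v⊗a + a⊗v)⁻¹`,
`deg (u⊗a - a⊗u) = gh = deg (v⊗a - a⊗v)⁻¹`. -/
def K10A.gamma2 (g h : G) : G → Submodule F (K10A F F) :=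
  gradingOf F
    ![K10A.bv F 0, K10A.bv F 1, K10A.bv F 3 - K10A.bv F 4,
      K10A.bv F 3 + K10A.bv F 4, K10A.bv F 2, K10A.bv F 5,
      K10A.bv F 6 + K10A.bv F 8, K10A.bv F 7 + K10A.bv F 9,
      K10A.bv F 6 - K10A.bv F 8, K10A.bv F 7 - K10A.bv F 9]
    ![1, 1, 1, h, g * g * h, g⁻¹ * g⁻¹ * h, g, g⁻¹, g * h, g⁻¹ * h]

end GradingDefs

end Kac

namespace Kac

section Generic

variable {G H S A : Type} [CommGroup G] [CommGroup H] [Field S]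
  [AddCommGroup A] [Module S A]

lemma eq_of_le_of_le_span {p q : Submodule S A} {w : A} (hp : p ≠ ⊥) (hpq : p ≤ q)
    (hq : q ≤ Submodule.span S {w}) : p = q := by
  obtain ⟨x, hx, hx0⟩ := Submodule.exists_mem_ne_zero_of_ne_bot hp
  obtain ⟨c, rfl⟩ := Submodule.mem_span_singleton.1 (hq (hpq hx))
  have hc : c ≠ 0 := by rintro rfl; simp at hx0
  refine le_antisymm hpq (hq.trans ?_)
  rw [Submodule.span_singleton_le_iff_mem]
  simpa [smul_smul, hc] using p.smul_mem c⁻¹ hx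

section GradingOf

variable {n : ℕ} {w : Fin n → A} {d : Fin n → G}

lemma mem_gradingOf (i : Fin n) : w i ∈ gradingOf S w d (d i) :=
  Submodule.subset_span ⟨i, rfl, rfl⟩

lemma exists_of_gradingOf_ne_bot {g : G} (h : gradingOf S w d g ≠ ⊥) : ∃ i, d i = g := by
  by_contra! hcon
  exact h (by simp [gradingOf, hcon])

lemma gradingOf_le_span {i : Fin n} (hi : ∀ j, d j = d i → j = i) :
    gradingOf S w d (d i) ≤ Submodule.span S {w i} := by
  refine Submodule.span_mono ?_
  rintro _ ⟨j, hj, rfl⟩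
  rw [hi j hj]; rfl

/-- Homogeneous elements with degrees factoring through `d` give a refinement. -/
lemma refines_map_gradingOf {H : Type} {Γ : H → Submodule S A} (φ : A →ₗ[S] A) (D : Fin n → H)
    (hD : ∀ i, φ (w i) ∈ Γ (D i)) (hdD : ∀ i j, d i = d j → D i = D j) :
    Refines (fun g => (gradingOf S w d g).map φ) Γ := by
  intro g hg
  obtain ⟨i, rfl⟩ : ∃ i, d i = g := by
    apply exists_of_gradingOf_ne_bot (S := S) (w := w)
    intro h
    exact hg (by simp only [h, Submodule.map_bot])
  refine ⟨D i, ?_⟩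
  simp only [gradingOf, Submodule.map_span_le]
  rintro _ ⟨j, hj, rfl⟩
  rw [← hdD j i hj]
  exact hD j

end GradingOf

variable [Mul A] {ev od : Submodule S A}

lemma IsSuperGrading.iSupIndep {Γ : G → Submodule S A} (hΓ : IsSuperGrading ev od Γ) :
    iSupIndep Γ := by
  classical
  exact ((DirectSum.isInternal_submodule_iff_iSupIndep_and_iSup_eq_top Γ).1
    (by convert hΓ.1)).1

lemma IsSuperGrading.iSup_eq_top {Γ : G → Submodule S A} (hΓ : IsSuperGrading ev od Γ) :
    ⨆ g, Γ g = ⊤ := by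
  classical
  exact ((DirectSum.isInternal_submodule_iff_iSupIndep_and_iSup_eq_top Γ).1
    (by convert hΓ.1)).2

lemma IsSuperGrading.mul_mem {Γ : G → Submodule S A} (hΓ : IsSuperGrading ev od Γ)
    {g h : G} {x y : A} (hx : x ∈ Γ g) (hy : y ∈ Γ h) : x * y ∈ Γ (g * h) :=
  hΓ.2.1 g h x y hx hy

lemma IsSuperGrading.degree_unique {Γ : G → Submodule S A} (hΓ : IsSuperGrading ev od Γ)
    {g h : G} {x : A} (hx : x ≠ 0) (hg : x ∈ Γ g) (hh : x ∈ Γ h) : g = h := by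
  by_contra hne
  exact hx (Submodule.disjoint_def.1 (hΓ.iSupIndep.pairwiseDisjoint hne) x hg hh)

lemma IsSuperGrading.degree_idempotent {Γ : G → Submodule S A} (hΓ : IsSuperGrading ev od Γ)
    {g : G} {x : A} (hx : x ≠ 0) (hxx : x * x = x) (hg : x ∈ Γ g) : g = 1 := by
  have h := hΓ.mul_mem hg hg
  rw [hxx] at h
  simpa using hΓ.degree_unique hx hg h

/-- Each parity component is spanned by its homogeneous elements. -/
lemma IsSuperGrading.iSup_inf {Γ : G → Submodule S A} (hΓ : IsSuperGrading ev od Γ)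
    (hd : Disjoint ev od) : ⨆ g, Γ g ⊓ ev = ev ∧ ⨆ g, Γ g ⊓ od = od := by
  have he : ⨆ g, Γ g ⊓ ev ≤ ev := iSup_le fun g => inf_le_right
  have ho : ⨆ g, Γ g ⊓ od ≤ od := iSup_le fun g => inf_le_right
  have ht : (⨆ g, Γ g ⊓ ev) ⊔ ⨆ g, Γ g ⊓ od = ⊤ := by
    rw [← iSup_sup_eq, ← hΓ.iSup_eq_top]
    exact iSup_congr fun g => (hΓ.2.2 g).symm
  refine ⟨le_antisymm he ?_, le_antisymm ho ?_⟩
  · calc ev = ((⨆ g, Γ g ⊓ ev) ⊔ ⨆ g, Γ g ⊓ od) ⊓ ev := by rw [ht, top_inf_eq]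
      _ ≤ ((⨆ g, Γ g ⊓ ev) ⊔ od) ⊓ ev := inf_le_inf_right _ (sup_le_sup_left ho _)
      _ = (⨆ g, Γ g ⊓ ev) ⊔ od ⊓ ev := (sup_inf_assoc_of_le od he).symm ▸ rfl
      _ = ⨆ g, Γ g ⊓ ev := by rw [hd.symm.eq_bot, sup_bot_eq]
  · calc od = ((⨆ g, Γ g ⊓ od) ⊔ ⨆ g, Γ g ⊓ ev) ⊓ od := by rw [sup_comm, ht, top_inf_eq]
      _ ≤ ((⨆ g, Γ g ⊓ od) ⊔ ev) ⊓ od := inf_le_inf_right _ (sup_le_sup_left he _)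
      _ = (⨆ g, Γ g ⊓ od) ⊔ ev ⊓ od := (sup_inf_assoc_of_le ev ho).symm ▸ rfl
      _ = ⨆ g, Γ g ⊓ od := by rw [hd.eq_bot, sup_bot_eq]

/-- A linear functional that is nonzero on the odd part is nonzero on some homogeneous odd
element. -/
lemma IsSuperGrading.exists_odd {Γ : G → Submodule S A} (hΓ : IsSuperGrading ev od Γ)
    (hd : Disjoint ev od) (f : A →ₗ[S] S) {x : A} (hx : x ∈ od) (hfx : f x ≠ 0) :
    ∃ g, ∃ y ∈ Γ g, y ∈ od ∧ f y ≠ 0 := by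
  by_contra! hcon
  have h : od ≤ LinearMap.ker f := by
    rw [← (hΓ.iSup_inf hd).2]
    exact iSup_le fun g y hy => hcon g y hy.1 hy.2
  exact hfx (h hx)

lemma Refines.exists_le {Δ : H → Submodule S A} {Γ : G → Submodule S A}
    (hΔ : IsSuperGrading ev od Δ) (hΓ : IsSuperGrading ev od Γ) (hr : Refines Δ Γ)
    {g : G} (hg : Γ g ≠ ⊥) : ∃ h, Δ h ≠ ⊥ ∧ Δ h ≤ Γ g := by
  by_contra! hcon
  have hle : ⨆ h, Δ h ≤ ⨆ (j) (_ : j ≠ g), Γ j := by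
    refine iSup_le fun h => ?_
    by_cases hb : Δ h = ⊥
    · simp [hb]
    · obtain ⟨j, hj⟩ := hr h hb
      have hjg : j ≠ g := by rintro rfl; exact hcon h hb hj
      exact hj.trans (le_iSup₂_of_le j hjg le_rfl)
  rw [hΔ.iSup_eq_top, top_le_iff] at hle
  have := hΓ.iSupIndep g
  rw [hle, disjoint_top] at this
  exact hg this

lemma isFine_of_eq {Γ : G → Submodule S A} (hΓ : IsSuperGrading ev od Γ)
    (h : ∀ (H : Type) (_ : CommGroup H) (Δ : H → Submodule S A), IsSuperGrading ev od Δ →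
      Refines Δ Γ → ∀ k g, Δ k ≠ ⊥ → Δ k ≤ Γ g → Δ k = Γ g) : IsFine ev od Γ := by
  intro H _ Δ hΔ hr
  ext p
  constructor
  · rintro ⟨hp, k, rfl⟩
    obtain ⟨g, hg⟩ := hr k hp
    exact ⟨hp, g, (h H _ Δ hΔ hr k g hp hg).symm⟩
  · rintro ⟨hp, g, rfl⟩
    obtain ⟨k, hk, hkg⟩ := hr.exists_le hΔ hΓ hp
    exact ⟨hp, k, h H _ Δ hΔ hr k g hk hkg⟩

/-- The image of a grading under an automorphism. -/
lemma IsSuperGrading.map {Δ : H → Submodule S A} (hΔ : IsSuperGrading ev od Δ)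
    (φ : SuperAut S A ev od) :
    IsSuperGrading ev od (fun h => (Δ h).map φ.e.toLinearMap) := by
  refine ⟨?_, ?_, ?_⟩
  · classical
    have : DirectSum.IsInternal (fun h => (Δ h).map φ.e.toLinearMap) := by
      rw [DirectSum.isInternal_submodule_iff_iSupIndep_and_iSup_eq_top]
      refine ⟨?_, ?_⟩
      · exact (iSupIndep_map_orderIso_iff (Submodule.orderIsoMapComap φ.e)).2 hΔ.iSupIndep
      · rw [← Submodule.map_iSup, hΔ.iSup_eq_top, Submodule.map_top, LinearMap.range_eq_top]
        exact φ.e.surjective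
    convert this
  · rintro g h _ _ ⟨x, hx, rfl⟩ ⟨y, hy, rfl⟩
    exact ⟨x * y, hΔ.mul_mem hx hy, φ.map_mul' x y⟩
  · intro g
    have hi : Function.Injective φ.e.toLinearMap := φ.e.injective
    have h := congrArg (Submodule.map φ.e.toLinearMap) (hΔ.2.2 g)
    rwa [Submodule.map_sup, Submodule.map_inf _ hi, Submodule.map_inf _ hi,
      φ.map_even, φ.map_odd] at h

/-- A fine grading that is refined by the image of another grading is equivalent to it. -/
lemma IsFine.gradEquiv {Γ : G → Submodule S A} {Δ : H → Submodule S A}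
    (hΓ : IsSuperGrading ev od Γ) (hΔ : IsSuperGrading ev od Δ) (hf : IsFine ev od Γ)
    (φ : SuperAut S A ev od)
    (hr : Refines (fun h => (Δ h).map φ.e.toLinearMap) Γ) : GradEquiv ev od Γ Δ := by
  have hset := hf H _ _ (hΔ.map φ) hr
  have hinv : ∀ p : Submodule S A, (p.map φ.e.toLinearMap).map (φ⁻¹).e.toLinearMap = p := by
    intro p
    have h : (φ⁻¹).e.toLinearMap ∘ₗ φ.e.toLinearMap = LinearMap.id :=
      LinearMap.ext fun x => φ.e.symm_apply_apply x
    rw [← Submodule.map_comp, h, Submodule.map_id]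
  have hex : ∀ g : {g : G // Γ g ≠ ⊥},
      ∃ h : {h : H // Δ h ≠ ⊥}, (Δ h.1).map φ.e.toLinearMap = Γ g.1 := by
    rintro ⟨g, hg⟩
    obtain ⟨-, h, hh⟩ : Γ g ∈ {p : Submodule S A | p ≠ ⊥ ∧
        ∃ h, (Δ h).map φ.e.toLinearMap = p} := by rw [hset]; exact ⟨hg, g, rfl⟩
    refine ⟨⟨h, ?_⟩, hh⟩
    intro hb
    rw [hb, Submodule.map_bot] at hh
    exact hg hh.symm
  choose α hα using hex
  refine ⟨φ⁻¹, α, ⟨?_, ?_⟩, fun g => by rw [← hα, hinv]⟩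
  · rintro ⟨g, hg⟩ ⟨g', hg'⟩ h
    have h1 : Γ g = Γ g' := by rw [← hα ⟨g, hg⟩, ← hα ⟨g', hg'⟩, h]
    obtain ⟨x, hx, hx0⟩ := Submodule.exists_mem_ne_zero_of_ne_bot hg
    exact Subtype.ext (hΓ.degree_unique hx0 hx (h1 ▸ hx))
  · rintro ⟨h, hh⟩
    have hne : (Δ h).map φ.e.toLinearMap ≠ ⊥ := by
      intro hb
      exact hh (by rw [← hinv (Δ h), hb, Submodule.map_bot])
    obtain ⟨-, g, hg⟩ : (Δ h).map φ.e.toLinearMap ∈ {p : Submodule S A | p ≠ ⊥ ∧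
        ∃ g, Γ g = p} := by rw [← hset]; exact ⟨hne, h, rfl⟩
    refine ⟨⟨g, hg ▸ hne⟩, ?_⟩
    obtain ⟨x, hx, hx0⟩ := Submodule.exists_mem_ne_zero_of_ne_bot hh
    refine Subtype.ext (hΔ.degree_unique hx0 ?_ hx)
    rw [← hinv (Δ (α _).1), hα, hg, hinv]
    exact hx

lemma isSuperGrading_gradingOf {A : Type} [NonUnitalNonAssocRing A] [Module S A]
    [IsScalarTower S A A] [SMulCommClass S A A] {ev od : Submodule S A}
    {n : ℕ} (w : Fin n → A) (d : Fin n → G)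
    (hli : LinearIndependent S w) (hsp : ⊤ ≤ Submodule.span S (Set.range w))
    (hpar : ∀ i, w i ∈ ev ∨ w i ∈ od)
    (hmul : ∀ i j, ∃ (k : Fin n) (c : S), w i * w j = c • w k ∧ (c = 0 ∨ d k = d i * d j)) :
    IsSuperGrading ev od (gradingOf S w d) := by
  refine ⟨?_, ?_, ?_⟩
  · classical
    have : DirectSum.IsInternal (gradingOf S w d) := by
      rw [DirectSum.isInternal_submodule_iff_iSupIndep_and_iSup_eq_top]
      refine ⟨?_, ?_⟩
      · intro g
        refine Disjoint.mono_right ?_ (hli.disjoint_span_image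
          (s := {i | d i = g}) (t := {i | d i ≠ g}) ?_)
        · refine iSup₂_le fun j hj => Submodule.span_mono (Set.image_mono ?_)
          rintro i rfl
          exact hj
        · exact Set.disjoint_left.2 fun i hi hi' => hi' hi
      · refine top_le_iff.1 (hsp.trans (Submodule.span_le.2 ?_))
        rintro _ ⟨i, rfl⟩
        exact Submodule.mem_iSup_of_mem (d i) (mem_gradingOf i)
    convert this
  · intro g h x y hx hy
    induction hx, hy using Submodule.span_induction₂ with
    | mem_mem x y hx hy =>
      obtain ⟨i, rfl, rfl⟩ := hx
      obtain ⟨j, rfl, rfl⟩ := hy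
      obtain ⟨k, c, hk, hd⟩ := hmul i j
      rcases hd with rfl | hd
      · simp [hk]
      · rw [hk, ← hd]
        exact Submodule.smul_mem _ _ (mem_gradingOf k)
    | zero_left y hy => simp
    | zero_right x hx => simp
    | add_left x y z _ _ _ h1 h2 => rw [add_mul]; exact add_mem h1 h2
    | add_right x y z _ _ _ h1 h2 => rw [mul_add]; exact add_mem h1 h2
    | smul_left r x y _ _ h => rw [smul_mul_assoc]; exact Submodule.smul_mem _ _ h
    | smul_right r x y _ _ h => rw [mul_smul_comm]; exact Submodule.smul_mem _ _ h
  · intro g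
    refine le_antisymm (Submodule.span_le.2 ?_) (sup_le inf_le_left inf_le_left)
    rintro _ ⟨i, rfl, rfl⟩
    rcases hpar i with h | h
    · exact Submodule.mem_sup_left ⟨mem_gradingOf i, h⟩
    · exact Submodule.mem_sup_right ⟨mem_gradingOf i, h⟩

end Generic

end Kac

namespace Kac

namespace K33A

variable {F : Type} [Field F]

lemma ext_coords {x y : K33A F F} (h0 : x 0 = y 0) (h1 : x 1 = y 1) (h2 : x 2 = y 2)
    (h3 : x 3 = y 3) (h4 : x 4 = y 4) (h5 : x 5 = y 5) : x = y := by
  funext i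
  fin_cases i <;> assumption

lemma mul_apply_zero (x y : K33A F F) :
    (x * y) 0 = x 0 * y 0 + (x 1 * y 2 - x 2 * y 1) := rfl
lemma mul_apply_one (x y : K33A F F) : (x * y) 1 = 2⁻¹ * (x 0 * y 1 + y 0 * x 1) := rfl
lemma mul_apply_two (x y : K33A F F) : (x * y) 2 = 2⁻¹ * (x 0 * y 2 + y 0 * x 2) := rfl
lemma mul_apply_three (x y : K33A F F) :
    (x * y) 3 = x 3 * y 3 + (x 4 * y 5 - x 5 * y 4) := rfl
lemma mul_apply_four (x y : K33A F F) : (x * y) 4 = 2⁻¹ * (x 3 * y 4 + y 3 * x 4) := rfl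
lemma mul_apply_five (x y : K33A F F) : (x * y) 5 = 2⁻¹ * (x 3 * y 5 + y 3 * x 5) := rfl

lemma mem_even {x : K33A F F} :
    x ∈ even F F F ↔ x 1 = 0 ∧ x 2 = 0 ∧ x 4 = 0 ∧ x 5 = 0 := by
  refine ⟨fun h => ⟨h 1 (by simp), h 2 (by simp), h 4 (by simp), h 5 (by simp)⟩, ?_⟩
  rintro ⟨h1, h2, h4, h5⟩ i hi
  fin_cases i <;> first | assumption | simp at hi

lemma mem_odd {x : K33A F F} : x ∈ odd F F F ↔ x 0 = 0 ∧ x 3 = 0 := by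
  refine ⟨fun h => ⟨h 0 (by simp), h 3 (by simp)⟩, ?_⟩
  rintro ⟨h0, h3⟩ i hi
  fin_cases i <;> first | assumption | simp at hi

lemma disjoint_even_odd : Disjoint (even F F F) (odd F F F) := by
  rw [Submodule.disjoint_def]
  intro x he ho
  obtain ⟨h1, h2, h4, h5⟩ := mem_even.1 he
  obtain ⟨h0, h3⟩ := mem_odd.1 ho
  exact ext_coords h0 h1 h2 h3 h4 h5

/-- The element with the given coordinates. -/
def ofCoords (a b c d e f : F) : K33A F F := ![a, b, c, d, e, f]

section

variable (a b c d e f : F)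

@[simp] lemma ofCoords_zero : ofCoords a b c d e f 0 = a := rfl
@[simp] lemma ofCoords_one : ofCoords a b c d e f 1 = b := rfl
@[simp] lemma ofCoords_two : ofCoords a b c d e f 2 = c := rfl
@[simp] lemma ofCoords_three : ofCoords a b c d e f 3 = d := rfl
@[simp] lemma ofCoords_four : ofCoords a b c d e f 4 = e := rfl
@[simp] lemma ofCoords_five : ofCoords a b c d e f 5 = f := rfl

end

lemma bv_apply (i j : Fin 6) : bv F i j = if j = i then 1 else 0 := Pi.single_apply i 1 j

/-- The ring structure carried by `K₃ × K₃`. -/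
abbrev nonUnitalNonAssocRing : NonUnitalNonAssocRing (K33A F F) where
  left_distrib x y z := by
    apply ext_coords <;> simp only [add_apply, mul_apply_zero, mul_apply_one, mul_apply_two,
      mul_apply_three, mul_apply_four, mul_apply_five] <;> ring
  right_distrib x y z := by
    apply ext_coords <;> simp only [add_apply, mul_apply_zero, mul_apply_one, mul_apply_two,
      mul_apply_three, mul_apply_four, mul_apply_five] <;> ring
  zero_mul x := by
    apply ext_coords <;> simp only [zero_apply, mul_apply_zero, mul_apply_one, mul_apply_two,
      mul_apply_three, mul_apply_four, mul_apply_five] <;> ring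
  mul_zero x := by
    apply ext_coords <;> simp only [zero_apply, mul_apply_zero, mul_apply_one, mul_apply_two,
      mul_apply_three, mul_apply_four, mul_apply_five] <;> ring

lemma isSuperGrading_gradingOf {G : Type} [CommGroup G] (w : Fin 6 → K33A F F) (d : Fin 6 → G)
    (hli : LinearIndependent F w) (hsp : ⊤ ≤ Submodule.span F (Set.range w))
    (hpar : ∀ i, w i ∈ even F F F ∨ w i ∈ odd F F F)
    (hmul : ∀ i j, ∃ (k : Fin 6) (c : F), w i * w j = c • w k ∧ (c = 0 ∨ d k = d i * d j)) :
    IsSuperGrading (even F F F) (odd F F F) (gradingOf F w d) := by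
  let : NonUnitalNonAssocRing (K33A F F) := nonUnitalNonAssocRing
  have : IsScalarTower F (K33A F F) (K33A F F) := ⟨fun c x y => by
    apply ext_coords <;> simp only [smul_eq_mul, smul_apply, mul_apply_zero, mul_apply_one,
      mul_apply_two, mul_apply_three, mul_apply_four, mul_apply_five] <;> ring⟩
  have : SMulCommClass F (K33A F F) (K33A F F) := ⟨fun c x y => by
    apply ext_coords <;> simp only [smul_eq_mul, smul_apply, mul_apply_zero, mul_apply_one,
      mul_apply_two, mul_apply_three, mul_apply_four, mul_apply_five] <;> ring⟩
  exact Kac.isSuperGrading_gradingOf w d hli hsp hpar hmul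

/-- The automorphism fixing the even part with `(u, u) ↦ x` and `(v, v) ↦ z` for two odd elements
`x` and `z` with `x * z = (a, a)`. -/
def symplecticAut (x z : K33A F F) (hl : x 1 * z 2 - x 2 * z 1 = 1)
    (hr : x 4 * z 5 - x 5 * z 4 = 1) :
    SuperAut F (K33A F F) (even F F F) (odd F F F) where
  e :=
    { toFun := fun t => ofCoords (t 0) (t 1 * x 1 + t 2 * z 1) (t 1 * x 2 + t 2 * z 2)
        (t 3) (t 4 * x 4 + t 5 * z 4) (t 4 * x 5 + t 5 * z 5)
      invFun := fun t => ofCoords (t 0) (t 1 * z 2 - t 2 * z 1) (t 2 * x 1 - t 1 * x 2)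
        (t 3) (t 4 * z 5 - t 5 * z 4) (t 5 * x 4 - t 4 * x 5)
      map_add' := fun s t => by apply ext_coords <;> simp <;> ring
      map_smul' := fun c t => by apply ext_coords <;> simp <;> ring
      left_inv := fun t => by
        apply ext_coords <;> simp
        · linear_combination t 1 * hl
        · linear_combination t 2 * hl
        · linear_combination t 4 * hr
        · linear_combination t 5 * hr
      right_inv := fun t => by
        apply ext_coords <;> simp
        · linear_combination t 1 * hl
        · linear_combination t 2 * hl
        · linear_combination t 4 * hr
        · linear_combination t 5 * hr }
  map_mul' s t := by
    apply ext_coords <;>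
      simp [mul_apply_zero, mul_apply_one, mul_apply_two, mul_apply_three, mul_apply_four,
        mul_apply_five]
    · linear_combination -(s 1 * t 2 - s 2 * t 1) * hl
    · ring
    · ring
    · linear_combination -(s 4 * t 5 - s 5 * t 4) * hr
    · ring
    · ring
  map_even := by
    refine le_antisymm ?_ fun t ht => ?_
    · rintro _ ⟨t, ht, rfl⟩
      obtain ⟨h1, h2, h4, h5⟩ := mem_even.1 ht
      simp [mem_even, h1, h2, h4, h5]
    · obtain ⟨h1, h2, h4, h5⟩ := mem_even.1 ht
      refine ⟨t, ht, ?_⟩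
      apply ext_coords <;> simp [h1, h2, h4, h5]
  map_odd := by
    refine le_antisymm ?_ fun t ht => ?_
    · rintro _ ⟨t, ht, rfl⟩
      obtain ⟨h0, h3⟩ := mem_odd.1 ht
      simp [mem_odd, h0, h3]
    · obtain ⟨h0, h3⟩ := mem_odd.1 ht
      refine ⟨ofCoords 0 (t 1 * z 2 - t 2 * z 1) (t 2 * x 1 - t 1 * x 2)
        0 (t 4 * z 5 - t 5 * z 4) (t 5 * x 4 - t 4 * x 5), by simp [mem_odd], ?_⟩
      apply ext_coords <;> simp [h0, h3]
      · linear_combination t 1 * hl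
      · linear_combination t 2 * hl
      · linear_combination t 4 * hr
      · linear_combination t 5 * hr

lemma symplecticAut_apply (x z : K33A F F) (hl : x 1 * z 2 - x 2 * z 1 = 1)
    (hr : x 4 * z 5 - x 5 * z 4 = 1) (t : K33A F F) :
    (symplecticAut x z hl hr).e.toLinearMap t =
      ofCoords (t 0) (t 1 * x 1 + t 2 * z 1) (t 1 * x 2 + t 2 * z 2)
        (t 3) (t 4 * x 4 + t 5 * z 4) (t 4 * x 5 + t 5 * z 5) := rfl

section Gamma

variable {G : Type} [CommGroup G]

lemma isSuperGrading_gamma1 (g₁ g₂ : G) :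
    IsSuperGrading (even F F F) (odd F F F) (gamma1 F g₁ g₂) := by
  apply isSuperGrading_gradingOf
  · rw [Fintype.linearIndependent_iff]
    intro c hc i
    have := congrFun hc i
    rw [Fin.sum_univ_six] at this
    fin_cases i <;> simpa [bv_apply] using this
  · intro x _
    rw [show x = ∑ i, x i • bv F i by
      rw [Fin.sum_univ_six]; apply ext_coords <;> simp [bv_apply]]
    exact sum_mem fun i _ => Submodule.smul_mem _ _ (Submodule.subset_span ⟨i, rfl⟩)
  · intro i
    fin_cases i <;> simp [mem_even, mem_odd, bv_apply]
  · intro i j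
    refine ⟨![![0, 1, 2, 0, 0, 0], ![1, 0, 0, 0, 0, 0], ![2, 0, 0, 0, 0, 0],
        ![0, 0, 0, 3, 4, 5], ![0, 0, 0, 4, 0, 3], ![0, 0, 0, 5, 3, 0]] i j,
      ![![1, 2⁻¹, 2⁻¹, 0, 0, 0], ![2⁻¹, 0, 1, 0, 0, 0], ![2⁻¹, -1, 0, 0, 0, 0],
        ![0, 0, 0, 1, 2⁻¹, 2⁻¹], ![0, 0, 0, 2⁻¹, 0, 1], ![0, 0, 0, 2⁻¹, -1, 0]] i j, ?_, ?_⟩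
    · fin_cases i <;> fin_cases j <;> apply ext_coords <;>
        simp [bv_apply, mul_apply_zero, mul_apply_one, mul_apply_two, mul_apply_three,
          mul_apply_four, mul_apply_five]
    · fin_cases i <;> fin_cases j <;> simp

lemma isSuperGrading_gamma2 (hchar : (2 : F) ≠ 0) (g h : G) (hh : h * h = 1) :
    IsSuperGrading (even F F F) (odd F F F) (gamma2 F g h) := by
  apply isSuperGrading_gradingOf
  · rw [Fintype.linearIndependent_iff]
    intro c hc
    rw [Fin.sum_univ_six] at hc
    have h0 : c 0 + c 1 = 0 := by simpa [bv_apply] using congrFun hc 0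
    have h3 : c 0 - c 1 = 0 := by simpa [bv_apply, sub_eq_add_neg] using congrFun hc 3
    have h1 : c 2 + c 4 = 0 := by simpa [bv_apply] using congrFun hc 1
    have h4 : c 2 - c 4 = 0 := by simpa [bv_apply, sub_eq_add_neg] using congrFun hc 4
    have h2 : c 3 + c 5 = 0 := by simpa [bv_apply] using congrFun hc 2
    have h5 : c 3 - c 5 = 0 := by simpa [bv_apply, sub_eq_add_neg] using congrFun hc 5
    intro i
    refine (mul_eq_zero.1 (?_ : 2 * c i = 0)).resolve_left hchar
    fin_cases i
    · change 2 * c 0 = 0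
      linear_combination h0 + h3
    · change 2 * c 1 = 0
      linear_combination h0 - h3
    · change 2 * c 2 = 0
      linear_combination h1 + h4
    · change 2 * c 3 = 0
      linear_combination h2 + h5
    · change 2 * c 4 = 0
      linear_combination h1 - h4
    · change 2 * c 5 = 0
      linear_combination h2 - h5
  · intro x _
    refine (Submodule.mem_span_range_iff_exists_fun F).2
      ⟨![(x 0 + x 3) / 2, (x 0 - x 3) / 2, (x 1 + x 4) / 2, (x 2 + x 5) / 2, (x 1 - x 4) / 2,
        (x 2 - x 5) / 2], ?_⟩
    rw [Fin.sum_univ_six]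
    apply ext_coords <;> simp [bv_apply] <;> field_simp <;> ring
  · intro i
    fin_cases i <;> simp [mem_even, mem_odd, bv_apply]
  · intro i j
    refine ⟨![![0, 1, 2, 3, 4, 5], ![1, 0, 4, 5, 2, 3], ![2, 4, 0, 0, 0, 1],
        ![3, 5, 0, 0, 1, 0], ![4, 2, 0, 1, 0, 0], ![5, 3, 1, 0, 0, 0]] i j,
      ![![1, 1, 2⁻¹, 2⁻¹, 2⁻¹, 2⁻¹], ![1, 1, 2⁻¹, 2⁻¹, 2⁻¹, 2⁻¹], ![2⁻¹, 2⁻¹, 0, 1, 0, 1],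
        ![2⁻¹, 2⁻¹, -1, 0, -1, 0], ![2⁻¹, 2⁻¹, 0, 1, 0, 1],
        ![2⁻¹, 2⁻¹, -1, 0, -1, 0]] i j, ?_, ?_⟩
    · fin_cases i <;> fin_cases j <;> apply ext_coords <;>
        simp [bv_apply, mul_apply_zero, mul_apply_one, mul_apply_two, mul_apply_three,
          mul_apply_four, mul_apply_five]
    · have hhx : ∀ x, h * (h * x) = x := fun x => by rw [← mul_assoc, hh, one_mul]
      fin_cases i <;> fin_cases j <;> simp [hh, hhx, mul_comm, mul_left_comm, mul_assoc]

end Gamma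

end K33A

end Kac

namespace Kac

namespace K33A

variable {F : Type} [Field F]

lemma bv_ne_zero (i : Fin 6) : bv F i ≠ 0 := fun h => by
  simpa [bv_apply] using congrFun h i

lemma even_le_of_mem {p : Submodule F (K33A F F)} (h0 : bv F 0 ∈ p) (h3 : bv F 3 ∈ p) :
    even F F F ≤ p := by
  intro x hx
  obtain ⟨h1, h2, h4, h5⟩ := mem_even.1 hx
  rw [show x = x 0 • bv F 0 + x 3 • bv F 3 by
    apply ext_coords <;> simp [bv_apply, h1, h2, h4, h5]]
  exact add_mem (Submodule.smul_mem _ _ h0) (Submodule.smul_mem _ _ h3)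

lemma even_le_gamma1 {G : Type} [CommGroup G] (g₁ g₂ : G) :
    even F F F ≤ gamma1 F g₁ g₂ 1 :=
  even_le_of_mem (mem_gradingOf (S := F) (w := bv F) (d := ![1, g₁, g₁⁻¹, 1, g₂, g₂⁻¹]) 0)
    (mem_gradingOf (S := F) (w := bv F) (d := ![1, g₁, g₁⁻¹, 1, g₂, g₂⁻¹]) 3)

lemma isFine_gamma1 :
    IsFine (even F F F) (odd F F F) (gamma1 F (Multiplicative.ofAdd ((1, 0) : ℤ × ℤ))
      (Multiplicative.ofAdd ((0, 1) : ℤ × ℤ))) := by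
  refine isFine_of_eq (isSuperGrading_gamma1 _ _) fun H _ Δ hΔ hr k g hk hkg => ?_
  set d : Fin 6 → Multiplicative (ℤ × ℤ) := ![1, Multiplicative.ofAdd (1, 0),
    (Multiplicative.ofAdd (1, 0))⁻¹, 1, Multiplicative.ofAdd (0, 1),
    (Multiplicative.ofAdd (0, 1))⁻¹] with hd
  have hinj : ∀ i, i ≠ 0 → i ≠ 3 → ∀ j, d j = d i → j = i := by
    rw [hd]
    clear hkg
    decide
  have hline : ∀ i, i ≠ 0 → i ≠ 3 → ∀ k, Δ k ≠ ⊥ → Δ k ≤ gradingOf F (bv F) d (d i) →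
      Δ k = gradingOf F (bv F) d (d i) := fun i h0 h3 k hk hle =>
    eq_of_le_of_le_span hk hle (gradingOf_le_span (hinj i h0 h3))
  have hbot : ∀ i, gradingOf F (bv F) d (d i) ≠ ⊥ := fun i =>
    Submodule.ne_bot_iff _ |>.2 ⟨bv F i, mem_gradingOf i, bv_ne_zero i⟩
  have hom : ∀ i, i ≠ 0 → i ≠ 3 → ∃ k, bv F i ∈ Δ k := fun i h0 h3 => by
    obtain ⟨k, hk, hle⟩ := hr.exists_le hΔ (isSuperGrading_gamma1 _ _) (hbot i)
    exact ⟨k, hline i h0 h3 k hk hle ▸ mem_gradingOf i⟩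
  have hone : ∀ i j l, i ≠ 0 → i ≠ 3 → j ≠ 0 → j ≠ 3 → bv F i * bv F j = bv F l →
      bv F l * bv F l = bv F l → bv F l ∈ Δ 1 := by
    intro i j l hi0 hi3 hj0 hj3 hl hll
    obtain ⟨k, hk⟩ := hom i hi0 hi3
    obtain ⟨k', hk'⟩ := hom j hj0 hj3
    have h := hΔ.mul_mem hk hk'
    rw [hl] at h
    rwa [hΔ.degree_idempotent (bv_ne_zero l) hll h] at h
  have hle : even F F F ≤ Δ 1 := by
    refine even_le_of_mem (hone 1 2 0 ?_ ?_ ?_ ?_ ?_ ?_) (hone 4 5 3 ?_ ?_ ?_ ?_ ?_ ?_)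
    all_goals first | decide | skip
    all_goals apply ext_coords <;> simp [bv_apply, mul_apply_zero, mul_apply_one, mul_apply_two,
      mul_apply_three, mul_apply_four, mul_apply_five]
  obtain ⟨i, rfl⟩ : ∃ i, d i = g := by
    apply exists_of_gradingOf_ne_bot (S := F) (w := bv F)
    intro hb
    exact hk (le_bot_iff.1 (hb ▸ hkg))
  by_cases hi : i ≠ 0 ∧ i ≠ 3
  · exact hline i hi.1 hi.2 k hk hkg
  · have h1 : gradingOf F (bv F) d (d i) ≤ even F F F := by
      rw [gradingOf, Submodule.span_le]
      rintro _ ⟨j, hj, rfl⟩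
      have hj' : j = 0 ∨ j = 3 := by
        by_contra! hj'
        rw [← hinj j hj'.1 hj'.2 i hj.symm] at hj'
        exact hi hj'
      rcases hj' with rfl | rfl <;> simp [mem_even, bv_apply]
    obtain ⟨x, hx, hx0⟩ := Submodule.exists_mem_ne_zero_of_ne_bot hk
    obtain rfl : k = 1 := hΔ.degree_unique hx0 hx (hle (h1 (hkg hx)))
    exact le_antisymm hkg (h1.trans hle)

lemma isFine_gamma2 (hchar : (2 : F) ≠ 0) :
    IsFine (even F F F) (odd F F F) (gamma2 F (Multiplicative.ofAdd ((1, 0) : ℤ × ZMod 2))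
      (Multiplicative.ofAdd ((0, 1) : ℤ × ZMod 2))) := by
  refine isFine_of_eq (isSuperGrading_gamma2 hchar _ _ (by decide))
    fun H _ Δ hΔ hr k g hk hkg => ?_
  obtain ⟨i, rfl⟩ := exists_of_gradingOf_ne_bot (fun hb => hk (le_bot_iff.1 (hb ▸ hkg)))
  exact eq_of_le_of_le_span hk hkg (gradingOf_le_span (by clear hkg; revert i; decide))

lemma not_gradEquiv_gamma1_gamma2 {G H : Type} [CommGroup G] [CommGroup H]
    (hchar : (2 : F) ≠ 0) (g₁ g₂ : G) (g h : H) (h1 : h ≠ 1) (hh : h * h = 1) :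
    ¬ GradEquiv (even F F F) (odd F F F) (gamma1 F g₁ g₂) (gamma2 F g h) := by
  rintro ⟨φ, α, -, hα⟩
  have hbot : gamma1 F g₁ g₂ 1 ≠ ⊥ := (Submodule.ne_bot_iff _).2
    ⟨bv F 0, even_le_gamma1 g₁ g₂ (by simp [mem_even, bv_apply]), bv_ne_zero 0⟩
  have hle : even F F F ≤ gamma2 F g h (α ⟨1, hbot⟩).1 := by
    rw [← hα]
    exact φ.map_even.ge.trans (Submodule.map_mono (even_le_gamma1 g₁ g₂))
  have hΓ := isSuperGrading_gamma2 hchar g h hh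
  have hp0 : bv F 0 + bv F 3 ≠ 0 := fun h => by simpa [bv_apply] using congrFun h 0
  have hm0 : bv F 0 - bv F 3 ≠ 0 := fun h => by simpa [bv_apply] using congrFun h 0
  have hp : bv F 0 + bv F 3 ∈ gamma2 F g h 1 := Submodule.subset_span ⟨0, rfl, rfl⟩
  have hm : bv F 0 - bv F 3 ∈ gamma2 F g h h := Submodule.subset_span ⟨1, rfl, rfl⟩
  have e1 := hΓ.degree_unique hp0 (hle (by simp [mem_even, bv_apply])) hp
  have e2 := hΓ.degree_unique hm0 (hle (by simp [mem_even, bv_apply])) hm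
  exact h1 (e2.symm.trans e1)

end K33A

end Kac

namespace Kac

namespace K33A

variable {F G : Type} [Field F] [CommGroup G] {Γ : G → Submodule F (K33A F F)}

/-- Either the even part is homogeneous of trivial degree, or `(a, -a)` is homogeneous of degree
of order two. -/
lemma even_dichotomy (hΓ : IsSuperGrading (even F F F) (odd F F F) Γ) :
    even F F F ≤ Γ 1 ∨ ∃ h : G, h ≠ 1 ∧ h * h = 1 ∧ ofCoords 1 0 0 (-1) 0 0 ∈ Γ h := by
  by_cases H : ∀ g, Γ g ⊓ even F F F ≤ Γ 1
  · left
    conv_lhs => rw [← (hΓ.iSup_inf disjoint_even_odd).1]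
    exact iSup_le H
  right
  obtain ⟨g, hg⟩ := not_forall.1 H
  obtain ⟨b, ⟨hbg, hbe⟩, hb1⟩ := SetLike.not_le_iff_exists.1 hg
  have hg1 : g ≠ 1 := by rintro rfl; exact hb1 hbg
  have hb0 : b ≠ 0 := by rintro rfl; exact hb1 (zero_mem _)
  obtain ⟨h1, h2, h4, h5⟩ := mem_even.1 hbe
  have hbb := hΓ.mul_mem hbg hbg
  have hsq : ∀ c : F, c ≠ 0 → b * b ≠ c • b := by
    intro c hc h
    have h' : c • b ∈ Γ (g * g) := h ▸ hbb
    exact hg1 (by simpa using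
      hΓ.degree_unique (smul_ne_zero hc hb0) (Submodule.smul_mem _ c hbg) h')
  have hx : b 0 ≠ 0 := by
    intro hx
    refine hsq (b 3) (fun h3 => hb0 (ext_coords hx h1 h2 h3 h4 h5)) ?_
    apply ext_coords <;> simp [mul_apply_zero, mul_apply_one, mul_apply_two, mul_apply_three,
      mul_apply_four, mul_apply_five, *]
  have hy : b 3 ≠ 0 := by
    intro hy
    refine hsq (b 0) hx ?_
    apply ext_coords <;> simp [mul_apply_zero, mul_apply_one, mul_apply_two, mul_apply_three,
      mul_apply_four, mul_apply_five, *]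
  have hgg : g * g ≠ g := by simpa using hg1
  have hbb0 : b * b ≠ 0 := by
    intro h
    simpa [mul_apply_zero, h1, h2, hx] using congrFun h 0
  have hsum : b 0 + b 3 = 0 := by
    by_contra hs
    have hb3 := hΓ.mul_mem hbg hbb
    have hrel : b * (b * b) + (b 0 * b 3) • b = (b 0 + b 3) • (b * b) := by
      apply ext_coords <;> simp [mul_apply_zero, mul_apply_one, mul_apply_two, mul_apply_three,
        mul_apply_four, mul_apply_five, h1, h2, h4, h5] <;> ring
    by_cases hggg : g * (g * g) = g
    · rw [hggg] at hb3
      have hmem : (b 0 + b 3) • (b * b) ∈ Γ g :=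
        hrel ▸ add_mem hb3 (Submodule.smul_mem _ _ hbg)
      exact hgg (hΓ.degree_unique (smul_ne_zero hs hbb0) (Submodule.smul_mem _ _ hbb) hmem)
    · have hmem : (b 0 * b 3) • b ∈ ⨆ (j) (_ : j ≠ g), Γ j := by
        rw [eq_sub_of_add_eq' hrel]
        exact sub_mem
          (Submodule.smul_mem _ _ (le_iSup₂_of_le (f := fun j (_ : j ≠ g) => Γ j) _ hgg le_rfl hbb))
          (le_iSup₂_of_le (f := fun j (_ : j ≠ g) => Γ j) _ hggg le_rfl hb3)
      exact smul_ne_zero (mul_ne_zero hx hy) hb0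
        (Submodule.disjoint_def.1 (hΓ.iSupIndep g) _ (Submodule.smul_mem _ _ hbg) hmem)
  have hy' : b 3 = -b 0 := (neg_eq_of_add_eq_zero_right hsum).symm
  have hone : ofCoords (1 : F) 0 0 1 0 0 ∈ Γ (g * g) := by
    convert Submodule.smul_mem _ ((b 0 * b 0)⁻¹) hbb using 1
    have hinv := inv_mul_cancel₀ (mul_ne_zero hx hx)
    apply ext_coords <;> simp only [smul_apply, smul_eq_mul, mul_apply_zero, mul_apply_one,
      mul_apply_two, mul_apply_three, mul_apply_four, mul_apply_five, h1, h2, h4, h5, hy', hinv,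
      ofCoords_zero, ofCoords_one, ofCoords_two, ofCoords_three, ofCoords_four, ofCoords_five,
      neg_mul_neg, mul_zero, sub_zero, add_zero]
  refine ⟨g, hg1, hΓ.degree_idempotent ?_ ?_ hone, ?_⟩
  · intro h
    simpa using congrFun h 0
  · apply ext_coords <;> simp [mul_apply_zero, mul_apply_one, mul_apply_two, mul_apply_three,
      mul_apply_four, mul_apply_five]
  · convert Submodule.smul_mem _ (b 0)⁻¹ hbg using 1
    apply ext_coords <;> simp [h1, h2, h4, h5, hy', hx]

lemma exists_odd_pairing (hΓ : IsSuperGrading (even F F F) (odd F F F) Γ) (i j : Fin 6) (r s : F)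
    {u : K33A F F} (hu : u ∈ odd F F F) (hru : r * u j - s * u i ≠ 0) :
    ∃ g, ∃ y ∈ Γ g, y ∈ odd F F F ∧ r * y j - s * y i ≠ 0 :=
  hΓ.exists_odd disjoint_even_odd
    { toFun := fun t => r * t j - s * t i
      map_add' := fun s t => by simp only [add_apply]; ring
      map_smul' := fun c t => by simp only [smul_apply, smul_eq_mul, RingHom.id_apply]; ring } hu hru

/-- A copy of `W` that is a homogeneous direct factor of the odd part has a homogeneous
symplectic basis. -/
lemma exists_symplectic_pair (hΓ : IsSuperGrading (even F F F) (odd F F F) Γ) (i j : Fin 6)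
    (ι : F → F → K33A F F) (hodd : ∀ p q, ι p q ∈ odd F F F) (hi : ∀ p q, ι p q i = p)
    (hj : ∀ p q, ι p q j = q) (hsmul : ∀ c p q, c • ι p q = ι (c * p) (c * q))
    (hom : ∀ g, ∀ y ∈ Γ g, y ∈ odd F F F → ι (y i) (y j) ∈ Γ g) :
    ∃ g k p q r s, ι p q ∈ Γ g ∧ ι r s ∈ Γ k ∧ p * s - q * r = 1 := by
  obtain ⟨g, x, hxg, hxo, hx⟩ := exists_odd_pairing hΓ i j 0 (-1) (hodd 1 0) (by simp [hi])
  have hx1 : x i ≠ 0 := by simpa using hx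
  obtain ⟨k, z, hzk, hzo, hz⟩ := exists_odd_pairing hΓ i j (x i) (x j) (hodd 0 1)
    (by simpa [hi, hj] using hx1)
  refine ⟨g, k, x i, x j, (x i * z j - x j * z i)⁻¹ * z i, (x i * z j - x j * z i)⁻¹ * z j,
    hom g x hxg hxo, hsmul _ _ _ ▸ Submodule.smul_mem _ _ (hom k z hzk hzo), ?_⟩
  rw [← inv_mul_cancel₀ hz]
  ring

/-- Homogeneous odd elements whose product is `(a, a)`, when `(a, -a)` is homogeneous of
nontrivial degree. -/
lemma exists_mul_eq_unit (hchar : (2 : F) ≠ 0)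
    (hΓ : IsSuperGrading (even F F F) (odd F F F) Γ) {h : G} (h1 : h ≠ 1) (hh : h * h = 1)
    (hb : ofCoords 1 0 0 (-1) 0 0 ∈ Γ h) :
    ∃ g k x z, x ∈ Γ g ∧ z ∈ Γ k ∧ x ∈ odd F F F ∧ z ∈ odd F F F ∧
      x 1 * z 2 - x 2 * z 1 = 1 ∧ x 4 * z 5 - x 5 * z 4 = 1 := by
  obtain ⟨g, x, hxg, hxo, hx⟩ := exists_odd_pairing hΓ 1 2 0 (-1)
    (u := ofCoords 0 1 0 0 0 0) (by simp [mem_odd]) (by simp)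
  have hx1 : x 1 ≠ 0 := by simpa using hx
  obtain ⟨k, z, hzk, hzo, hz⟩ := exists_odd_pairing hΓ 1 2 (x 1) (x 2)
    (u := ofCoords 0 0 1 0 0 0) (by simp [mem_odd]) (by simpa using hx1)
  obtain ⟨hx0, hx3⟩ := mem_odd.1 hxo
  obtain ⟨hz0, hz3⟩ := mem_odd.1 hzo
  set p := x 1 * z 2 - x 2 * z 1 with hp
  set q := x 4 * z 5 - x 5 * z 4 with hq
  have hone : ofCoords (1 : F) 0 0 1 0 0 ∈ Γ 1 := by
    rw [← hh]
    convert hΓ.mul_mem hb hb using 1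
    apply ext_coords <;> simp [mul_apply_zero, mul_apply_one, mul_apply_two, mul_apply_three,
      mul_apply_four, mul_apply_five]
  have hone0 : ofCoords (1 : F) 0 0 1 0 0 ≠ 0 := fun h0 => by simpa using congrFun h0 0
  have hb0 : ofCoords (1 : F) 0 0 (-1) 0 0 ≠ 0 := fun h0 => by simpa using congrFun h0 0
  have hxz := hΓ.mul_mem hxg hzk
  have hrel : (p + q) • ofCoords (1 : F) 0 0 1 0 0 + (p - q) • ofCoords (1 : F) 0 0 (-1) 0 0 =
      (2 : F) • (x * z) := by
    apply ext_coords <;> simp [mul_apply_zero, mul_apply_one, mul_apply_two, mul_apply_three,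
      mul_apply_four, mul_apply_five, hx0, hx3, hz0, hz3, ← hp, ← hq] <;> ring
  have hpq : p - q = 0 ∨ p + q = 0 := by
    by_contra! hne
    by_cases hgk : g * k = 1
    · rw [hgk] at hxz
      have hmem : (p - q) • ofCoords (1 : F) 0 0 (-1) 0 0 ∈ Γ 1 := by
        rw [eq_sub_of_add_eq' hrel]
        exact sub_mem (Submodule.smul_mem _ _ hxz) (Submodule.smul_mem _ _ hone)
      exact h1 (hΓ.degree_unique (smul_ne_zero hne.1 hb0) (Submodule.smul_mem _ _ hb) hmem)
    · have hmem : (p + q) • ofCoords (1 : F) 0 0 1 0 0 ∈ ⨆ (j) (_ : j ≠ (1 : G)), Γ j := by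
        rw [eq_sub_of_add_eq hrel]
        exact sub_mem (Submodule.smul_mem _ _
            (le_iSup₂_of_le (f := fun j (_ : j ≠ (1 : G)) => Γ j) _ hgk le_rfl hxz))
          (Submodule.smul_mem _ _
            (le_iSup₂_of_le (f := fun j (_ : j ≠ (1 : G)) => Γ j) _ h1 le_rfl hb))
      exact smul_ne_zero hne.2 hone0
        (Submodule.disjoint_def.1 (hΓ.iSupIndep 1) _ (Submodule.smul_mem _ _ hone) hmem)
  rcases hpq with hpq | hpq
  · refine ⟨g, k, x, p⁻¹ • z, hxg, Submodule.smul_mem _ _ hzk, hxo, Submodule.smul_mem _ _ hzo,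
      ?_, ?_⟩
    · simp only [smul_apply, smul_eq_mul]
      linear_combination inv_mul_cancel₀ hz
    · simp only [smul_apply, smul_eq_mul]
      linear_combination inv_mul_cancel₀ hz - p⁻¹ * hpq
  · refine ⟨g, h * k, x, (2 * p⁻¹) • (ofCoords 1 0 0 (-1) 0 0 * z), hxg,
      Submodule.smul_mem _ _ (hΓ.mul_mem hb hzk), hxo, Submodule.smul_mem _ _ ?_, ?_, ?_⟩
    · simp [mem_odd, mul_apply_zero, mul_apply_three, hz0, hz3]
    · simp only [smul_apply, smul_eq_mul, mul_apply_one, mul_apply_two, ofCoords_zero,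
        ofCoords_one, ofCoords_two]
      linear_combination inv_mul_cancel₀ hz + p⁻¹ * p * mul_inv_cancel₀ hchar
    · simp only [smul_apply, smul_eq_mul, mul_apply_four, mul_apply_five, ofCoords_three,
        ofCoords_four, ofCoords_five]
      linear_combination inv_mul_cancel₀ hz - p⁻¹ * q * mul_inv_cancel₀ hchar - p⁻¹ * hpq

lemma gradEquiv_gamma1 (hchar : (2 : F) ≠ 0) (hΓ : IsSuperGrading (even F F F) (odd F F F) Γ)
    (hf : IsFine (even F F F) (odd F F F) Γ) (he : even F F F ≤ Γ 1) :
    GradEquiv (even F F F) (odd F F F) Γ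
      (gamma1 F (Multiplicative.ofAdd ((1, 0) : ℤ × ℤ))
        (Multiplicative.ofAdd ((0, 1) : ℤ × ℤ))) := by
  have hleft : ∀ g, ∀ y ∈ Γ g, y ∈ odd F F F → ofCoords 0 (y 1) (y 2) 0 0 0 ∈ Γ g := by
    intro g y hy hyo
    have h := Submodule.smul_mem _ (2 : F) (hΓ.mul_mem
      (he (mem_even.2 (by simp) : ofCoords (1 : F) 0 0 0 0 0 ∈ _)) hy)
    rw [one_mul] at h
    convert h using 1
    apply ext_coords <;> simp [mul_apply_zero, mul_apply_one, mul_apply_two, mul_apply_three,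
      mul_apply_four, mul_apply_five, mem_odd.1 hyo, hchar]
  have hright : ∀ g, ∀ y ∈ Γ g, y ∈ odd F F F → ofCoords 0 0 0 0 (y 4) (y 5) ∈ Γ g := by
    intro g y hy hyo
    have h := Submodule.smul_mem _ (2 : F) (hΓ.mul_mem
      (he (mem_even.2 (by simp) : ofCoords (0 : F) 0 0 1 0 0 ∈ _)) hy)
    rw [one_mul] at h
    convert h using 1
    apply ext_coords <;> simp [mul_apply_zero, mul_apply_one, mul_apply_two, mul_apply_three,
      mul_apply_four, mul_apply_five, mem_odd.1 hyo, hchar]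
  obtain ⟨g, k, p, q, r, s, hx, hz, hl⟩ := exists_symplectic_pair hΓ 1 2
    (fun p q => ofCoords 0 p q 0 0 0) (by simp [mem_odd]) (by simp) (by simp)
    (fun c p q => by apply ext_coords <;> simp) hleft
  obtain ⟨g', k', p', q', r', s', hx', hz', hr⟩ := exists_symplectic_pair hΓ 4 5
    (fun p q => ofCoords 0 0 0 0 p q) (by simp [mem_odd]) (by simp) (by simp)
    (fun c p q => by apply ext_coords <;> simp) hright
  refine hf.gradEquiv hΓ (isSuperGrading_gamma1 _ _)
    (symplecticAut (ofCoords 0 p q 0 p' q') (ofCoords 0 r s 0 r' s') (by simpa using hl)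
      (by simpa using hr))
    (refines_map_gradingOf _ ![1, g, k, 1, g', k'] (fun i => ?_) ?_)
  · rw [symplecticAut_apply]
    fin_cases i
    · exact he (by simp [mem_even, bv_apply])
    · change _ ∈ Γ g
      simpa [bv_apply] using hx
    · change _ ∈ Γ k
      simpa [bv_apply] using hz
    · exact he (by simp [mem_even, bv_apply])
    · change _ ∈ Γ g'
      simpa [bv_apply] using hx'
    · change _ ∈ Γ k'
      simpa [bv_apply] using hz'
  · intro i j hij
    have hij' : i = j ∨ (i = 0 ∧ j = 3) ∨ (i = 3 ∧ j = 0) := by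
      revert hij
      revert i j
      decide
    rcases hij' with rfl | ⟨rfl, rfl⟩ | ⟨rfl, rfl⟩ <;> rfl

lemma gradEquiv_gamma2 (hchar : (2 : F) ≠ 0) (hΓ : IsSuperGrading (even F F F) (odd F F F) Γ)
    (hf : IsFine (even F F F) (odd F F F) Γ) {h : G} (h1 : h ≠ 1) (hh : h * h = 1)
    (hb : ofCoords 1 0 0 (-1) 0 0 ∈ Γ h) :
    GradEquiv (even F F F) (odd F F F) Γ
      (gamma2 F (Multiplicative.ofAdd ((1, 0) : ℤ × ZMod 2))
        (Multiplicative.ofAdd ((0, 1) : ℤ × ZMod 2))) := by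
  obtain ⟨g, k, x, z, hx, hz, hxo, hzo, hl, hr⟩ := exists_mul_eq_unit hchar hΓ h1 hh hb
  obtain ⟨hx0, hx3⟩ := mem_odd.1 hxo
  obtain ⟨hz0, hz3⟩ := mem_odd.1 hzo
  refine hf.gradEquiv hΓ (isSuperGrading_gamma2 hchar _ _ (by decide)) (symplecticAut x z hl hr)
    (refines_map_gradingOf _ ![h * h, h, g, k, h * g, h * k] (fun i => ?_) ?_)
  · rw [symplecticAut_apply]
    fin_cases i
    · change _ ∈ Γ (h * h)
      convert hΓ.mul_mem hb hb using 1
      apply ext_coords <;> simp [bv_apply, mul_apply_zero, mul_apply_one, mul_apply_two,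
        mul_apply_three, mul_apply_four, mul_apply_five]
    · change _ ∈ Γ h
      convert hb using 1
      apply ext_coords <;> simp [bv_apply]
    · change _ ∈ Γ g
      convert hx using 1
      apply ext_coords <;> simp [bv_apply, hx0, hx3]
    · change _ ∈ Γ k
      convert hz using 1
      apply ext_coords <;> simp [bv_apply, hz0, hz3]
    · change _ ∈ Γ (h * g)
      convert Submodule.smul_mem _ (2 : F) (hΓ.mul_mem hb hx) using 1
      apply ext_coords <;> simp [bv_apply, mul_apply_zero, mul_apply_one, mul_apply_two,
        mul_apply_three, mul_apply_four, mul_apply_five, hx0, hx3, hchar]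
    · change _ ∈ Γ (h * k)
      convert Submodule.smul_mem _ (2 : F) (hΓ.mul_mem hb hz) using 1
      apply ext_coords <;> simp [bv_apply, mul_apply_zero, mul_apply_one, mul_apply_two,
        mul_apply_three, mul_apply_four, mul_apply_five, hz0, hz3, hchar]
  · intro i j hij
    obtain rfl : i = j := by
      revert hij
      revert i j
      decide
    rfl

end K33A

end Kac

/-! ### STATEMENT 16 -/

open Kac in
/-- Up to equivalence there are exactly two fine gradings on `K₃ × K₃`:
`Γ¹(ℤ²; (1,0), (0,1))` and `Γ²(ℤ × ℤ/2; (1,0̄), (0,1̄))`. -/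
theorem fine_gradings_on_K3xK3 (F : Type) [Field F] (hchar : (2 : F) ≠ 0) :
    (IsSuperGrading (K33A.even F F F) (K33A.odd F F F)
      (K33A.gamma1 F (Multiplicative.ofAdd ((1, 0) : ℤ × ℤ))
        (Multiplicative.ofAdd ((0, 1) : ℤ × ℤ))) ∧
     IsFine (K33A.even F F F) (K33A.odd F F F)
      (K33A.gamma1 F (Multiplicative.ofAdd ((1, 0) : ℤ × ℤ))
        (Multiplicative.ofAdd ((0, 1) : ℤ × ℤ)))) ∧
    (IsSuperGrading (K33A.even F F F) (K33A.odd F F F)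
      (K33A.gamma2 F (Multiplicative.ofAdd ((1, 0) : ℤ × ZMod 2))
        (Multiplicative.ofAdd ((0, 1) : ℤ × ZMod 2))) ∧
     IsFine (K33A.even F F F) (K33A.odd F F F)
      (K33A.gamma2 F (Multiplicative.ofAdd ((1, 0) : ℤ × ZMod 2))
        (Multiplicative.ofAdd ((0, 1) : ℤ × ZMod 2)))) ∧
    ¬ GradEquiv (K33A.even F F F) (K33A.odd F F F)
      (K33A.gamma1 F (Multiplicative.ofAdd ((1, 0) : ℤ × ℤ))
        (Multiplicative.ofAdd ((0, 1) : ℤ × ℤ)))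
      (K33A.gamma2 F (Multiplicative.ofAdd ((1, 0) : ℤ × ZMod 2))
        (Multiplicative.ofAdd ((0, 1) : ℤ × ZMod 2))) ∧
    (∀ (G : Type) (_ : CommGroup G) (Γ : G → Submodule F (K33A F F)),
      IsSuperGrading (K33A.even F F F) (K33A.odd F F F) Γ →
      IsFine (K33A.even F F F) (K33A.odd F F F) Γ →
      GradEquiv (K33A.even F F F) (K33A.odd F F F) Γ
        (K33A.gamma1 F (Multiplicative.ofAdd ((1, 0) : ℤ × ℤ))
          (Multiplicative.ofAdd ((0, 1) : ℤ × ℤ))) ∨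
      GradEquiv (K33A.even F F F) (K33A.odd F F F) Γ
        (K33A.gamma2 F (Multiplicative.ofAdd ((1, 0) : ℤ × ZMod 2))
          (Multiplicative.ofAdd ((0, 1) : ℤ × ZMod 2)))) := by
  refine ⟨⟨K33A.isSuperGrading_gamma1 _ _, K33A.isFine_gamma1⟩,
    ⟨K33A.isSuperGrading_gamma2 hchar _ _ (by decide), K33A.isFine_gamma2 hchar⟩,
    K33A.not_gradEquiv_gamma1_gamma2 hchar _ _ _ _ (by decide) (by decide),
    fun G _ Γ hΓ hf => ?_⟩
  rcases K33A.even_dichotomy hΓ with he | ⟨h, h1, hh, hb⟩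
  · exact Or.inl (K33A.gradEquiv_gamma1 hchar hΓ hf he)
  · exact Or.inr (K33A.gradEquiv_gamma2 hchar hΓ hf h1 hh hb)
end
end

section
/- Let G be an abelian group with neutral element e. Every G-grading on K₁₀ is isomorphic either to Γ¹_{K₁₀}(G;g₁,g₂) for some g₁,g₂ ∈ G, or to Γ²_{K₁₀}(G;g,h) for some g,h ∈ G with h² = e ≠ h. -/
open scoped TensorProduct
noncomputable section
/-! ### Families of submodules indexed by a group -/

namespace Kac

section General

variable {F G A : Type} [CommRing F] [AddCommGroup A] [Module F A]

lemma eq_of_le_of_iSup_eq_top {Γ Δ : G → Submodule F A} (hΓ : iSupIndep Γ)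
    (hle : ∀ g, Δ g ≤ Γ g) (hΔ : ⨆ g, Δ g = ⊤) (g : G) : Δ g = Γ g := by
  refine le_antisymm (hle g) fun x hx => ?_
  have htop : Δ g ⊔ ⨆ (j) (_ : j ≠ g), Δ j = ⊤ := by
    rw [eq_top_iff, ← hΔ]
    refine iSup_le fun k => ?_
    by_cases hk : k = g
    · exact hk ▸ le_sup_left
    · exact le_sup_of_le_right (le_iSup₂_of_le k hk le_rfl)
  obtain ⟨y, hy, z, hz, rfl⟩ := Submodule.mem_sup.1 (htop ▸ Submodule.mem_top : x ∈ _)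
  have hzg : z ∈ Γ g := by simpa using (Γ g).sub_mem hx (hle g hy)
  have hz' : z ∈ ⨆ (j) (_ : j ≠ g), Γ j := iSup₂_mono (fun j _ => hle j) hz
  have : z = 0 := Submodule.disjoint_def.1 (hΓ g) z hzg hz'
  simpa [this] using hy

lemma iSup_gradingOf [CommGroup G] {n : ℕ} (w : Fin n → A) (d : Fin n → G)
    (hw : Submodule.span F (Set.range w) = ⊤) : ⨆ g, gradingOf F w d g = ⊤ := by
  rw [eq_top_iff, ← hw, Submodule.span_le]
  rintro _ ⟨i, rfl⟩
  exact Submodule.mem_iSup_of_mem (d i) (Submodule.subset_span ⟨i, rfl, rfl⟩)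

lemma eq_of_mem_of_mem {Γ : G → Submodule F A} (hΓ : iSupIndep Γ) {g h : G} {x : A}
    (hg : x ∈ Γ g) (hh : x ∈ Γ h) (hx : x ≠ 0) : g = h := by
  by_contra hne
  exact hx (Submodule.disjoint_def.1 (hΓ.pairwiseDisjoint hne) x hg hh)

end General

/-! ### The structure of `K₁₀` over a field -/

namespace K10A

variable {F : Type} [Field F]

lemma mul_apply (x y : K10A F F) :
    (x * y) 0 = x 0 * y 0 - 3 * 2⁻¹ ^ 4 * (x 1 * y 1)
      + 3 * 2⁻¹ ^ 2 * (x 2 * y 5 + x 5 * y 2 - x 3 * y 4 - x 4 * y 3)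
      - 3 * 2⁻¹ ^ 3 * (x 6 * y 7 - x 7 * y 6 + x 8 * y 9 - x 9 * y 8) ∧
    (x * y) 1 = x 0 * y 1 + x 1 * y 0 + x 1 * y 1
      - (x 2 * y 5 + x 5 * y 2 - x 3 * y 4 - x 4 * y 3)
      + (x 6 * y 7 - x 7 * y 6) + (x 8 * y 9 - x 9 * y 8) ∧
    (x * y) 2 = x 0 * y 2 + x 2 * y 0 + 2⁻¹ ^ 2 * (x 1 * y 2 + x 2 * y 1)
      + 2⁻¹ ^ 2 * (x 6 * y 8 - x 8 * y 6) ∧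
    (x * y) 3 = x 0 * y 3 + x 3 * y 0 + 2⁻¹ ^ 2 * (x 1 * y 3 + x 3 * y 1)
      + 2⁻¹ ^ 2 * (x 6 * y 9 - x 9 * y 6) ∧
    (x * y) 4 = x 0 * y 4 + x 4 * y 0 + 2⁻¹ ^ 2 * (x 1 * y 4 + x 4 * y 1)
      + 2⁻¹ ^ 2 * (x 7 * y 8 - x 8 * y 7) ∧
    (x * y) 5 = x 0 * y 5 + x 5 * y 0 + 2⁻¹ ^ 2 * (x 1 * y 5 + x 5 * y 1)
      + 2⁻¹ ^ 2 * (x 7 * y 9 - x 9 * y 7) ∧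
    (x * y) 6 = x 0 * y 6 + x 6 * y 0 + 2⁻¹ * (x 1 * y 6 + x 6 * y 1)
      + 2⁻¹ * (x 2 * y 9 + x 9 * y 2) - 2⁻¹ * (x 3 * y 8 + x 8 * y 3) ∧
    (x * y) 7 = x 0 * y 7 + x 7 * y 0 + 2⁻¹ * (x 1 * y 7 + x 7 * y 1)
      + 2⁻¹ * (x 4 * y 9 + x 9 * y 4) - 2⁻¹ * (x 5 * y 8 + x 8 * y 5) ∧
    (x * y) 8 = x 0 * y 8 + x 8 * y 0 + 2⁻¹ * (x 1 * y 8 + x 8 * y 1)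
      - 2⁻¹ * (x 2 * y 7 + x 7 * y 2) + 2⁻¹ * (x 4 * y 6 + x 6 * y 4) ∧
    (x * y) 9 = x 0 * y 9 + x 9 * y 0 + 2⁻¹ * (x 1 * y 9 + x 9 * y 1)
      - 2⁻¹ * (x 3 * y 7 + x 7 * y 3) + 2⁻¹ * (x 5 * y 6 + x 6 * y 5) := by
  have h4 : (2⁻¹ : F) ^ 2 = 4⁻¹ := by rw [inv_pow]; norm_num
  have h8 : (2⁻¹ : F) ^ 3 = 8⁻¹ := by rw [inv_pow]; norm_num
  have h16 : (2⁻¹ : F) ^ 4 = 16⁻¹ := by rw [inv_pow]; norm_num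
  rw [h4, h8, h16, ← div_eq_mul_inv, ← div_eq_mul_inv, ← div_eq_mul_inv]
  exact ⟨rfl, rfl, rfl, rfl, rfl, rfl, rfl, rfl, rfl, rfl⟩

lemma ext_coord {x y : K10A F F} (h0 : x 0 = y 0) (h1 : x 1 = y 1) (h2 : x 2 = y 2)
    (h3 : x 3 = y 3) (h4 : x 4 = y 4) (h5 : x 5 = y 5) (h6 : x 6 = y 6) (h7 : x 7 = y 7)
    (h8 : x 8 = y 8) (h9 : x 9 = y 9) : x = y := by
  funext i
  fin_cases i <;> assumption

/-- Multiplication as a bilinear map. -/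
def mulBilin (F : Type) [Field F] : K10A F F →ₗ[F] K10A F F →ₗ[F] K10A F F :=
  LinearMap.mk₂ F (· * ·)
    (fun x y z => by apply ext_coord <;> simp only [mul_apply, add_apply] <;> ring)
    (fun c x y => by apply ext_coord <;> simp only [mul_apply, smul_apply, smul_eq_mul] <;> ring)
    (fun x y z => by apply ext_coord <;> simp only [mul_apply, add_apply] <;> ring)
    (fun c x y => by apply ext_coord <;> simp only [mul_apply, smul_apply, smul_eq_mul] <;> ring)

@[simp] lemma mulBilin_apply (x y : K10A F F) : mulBilin F x y = x * y := rfl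

/-- The linear endomorphism with values `α` on `W ⊗ a`, `β` on `a ⊗ W`, and `0` on the even part. -/
def oddScale (α β : F) : K10A F F →ₗ[F] K10A F F where
  toFun x := ![0, 0, 0, 0, 0, 0, α * x 6, α * x 7, β * x 8, β * x 9]
  map_add' x y := by
    funext i; fin_cases i <;> first | exact (add_zero (0 : F)).symm | exact mul_add _ _ _
  map_smul' c x := by
    funext i; fin_cases i <;> first | exact (mul_zero c).symm | exact mul_left_comm _ _ _

lemma oddScale_apply (α β : F) (x : K10A F F) :
    oddScale α β x 0 = 0 ∧ oddScale α β x 1 = 0 ∧ oddScale α β x 2 = 0 ∧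
    oddScale α β x 3 = 0 ∧ oddScale α β x 4 = 0 ∧ oddScale α β x 5 = 0 ∧
    oddScale α β x 6 = α * x 6 ∧ oddScale α β x 7 = α * x 7 ∧
    oddScale α β x 8 = β * x 8 ∧ oddScale α β x 9 = β * x 9 :=
  ⟨rfl, rfl, rfl, rfl, rfl, rfl, rfl, rfl, rfl, rfl⟩

/-- The skew-symmetric form on the odd part, extended by zero to the even part. -/
def oddForm (F : Type) [Field F] : K10A F F →ₗ[F] K10A F F →ₗ[F] F :=
  LinearMap.mk₂ F (fun x y => x 6 * y 7 - x 7 * y 6 + x 8 * y 9 - x 9 * y 8)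
    (fun x y z => by simp only [add_apply]; ring)
    (fun c x y => by simp only [smul_apply, smul_eq_mul]; ring)
    (fun x y z => by simp only [add_apply]; ring)
    (fun c x y => by simp only [smul_apply, smul_eq_mul]; ring)

lemma oddForm_apply (x y : K10A F F) :
    oddForm F x y = x 6 * y 7 - x 7 * y 6 + x 8 * y 9 - x 9 * y 8 := rfl

lemma oddForm_oddScale (α β : F) (x y : K10A F F) :
    oddForm F (oddScale α β x) y = oddForm F x (oddScale α β y) := by
  simp only [oddForm_apply, oddScale_apply]; ring

lemma mem_odd_iff {x : K10A F F} : x ∈ odd F F F ↔ oddScale 1 1 x = x := by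
  constructor
  · intro h
    have h' : ∀ i, i ∉ ({6, 7, 8, 9} : Set (Fin 10)) → x i = 0 := h
    apply ext_coord <;> simp only [oddScale_apply, one_mul] <;> exact (h' _ (by simp)).symm
  · intro h i hi
    rw [← h]
    fin_cases i <;> first | rfl | simp at hi

lemma oddScale_of_mem_even {x : K10A F F} (hx : x ∈ even F F F) (α β : F) :
    oddScale α β x = 0 := by
  have h' : ∀ i, i ∉ ({0, 1, 2, 3, 4, 5} : Set (Fin 10)) → x i = 0 := hx
  apply ext_coord <;> simp only [oddScale_apply, zero_apply] <;>
    rw [h' _ (by simp), mul_zero]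

lemma oddScale_oddScale (α β γ δ : F) (x : K10A F F) :
    oddScale α β (oddScale γ δ x) = oddScale (α * γ) (β * δ) x := by
  apply ext_coord <;> simp only [oddScale_apply, mul_assoc]

lemma oddScale_mem_odd (α β : F) (x : K10A F F) : oddScale α β x ∈ odd F F F := by
  rw [mem_odd_iff, oddScale_oddScale, one_mul, one_mul]

instance : Module.Finite F (K10A F F) := inferInstanceAs (Module.Finite F (Fin 10 → F))
instance : Module.Free F (K10A F F) := inferInstanceAs (Module.Free F (Fin 10 → F))

/-- The basis `bv` as a `Module.Basis`. -/
def basis (F : Type) [Field F] : Module.Basis (Fin 10) F (K10A F F) := Pi.basisFun F (Fin 10)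

lemma coe_basis : ⇑(basis F) = bv F := by
  funext i; exact Pi.basisFun_apply F _ i

lemma basis_repr (x : K10A F F) (i : Fin 10) : (basis F).repr x i = x i := rfl

lemma trace_eq (f : K10A F F →ₗ[F] K10A F F) :
    LinearMap.trace F (K10A F F) f = ∑ i, f (bv F i) i := by
  rw [LinearMap.trace_eq_matrix_trace F (basis F) f]
  refine Finset.sum_congr rfl fun i _ => ?_
  rw [Matrix.diag_apply, LinearMap.toMatrix_apply, coe_basis, basis_repr]

lemma span_bv : Submodule.span F (Set.range (bv F)) = ⊤ := by
  rw [← coe_basis, (basis F).span_eq]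


lemma bv_apply (i j : Fin 10) : bv F i j = if j = i then 1 else 0 := Pi.single_apply _ _ _

lemma oneE_apply :
    oneE F F 0 = 1 ∧ oneE F F 1 = 0 ∧ oneE F F 2 = 0 ∧ oneE F F 3 = 0 ∧ oneE F F 4 = 0 ∧
    oneE F F 5 = 0 ∧ oneE F F 6 = 0 ∧ oneE F F 7 = 0 ∧ oneE F F 8 = 0 ∧ oneE F F 9 = 0 :=
  ⟨rfl, rfl, rfl, rfl, rfl, rfl, rfl, rfl, rfl, rfl⟩

lemma oneE_mul (x : K10A F F) : oneE F F * x = x := by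
  apply ext_coord <;> simp only [mul_apply, oneE_apply] <;> ring

lemma mul_oneE (x : K10A F F) : x * oneE F F = x := by
  apply ext_coord <;> simp only [mul_apply, oneE_apply] <;> ring

/-- This functional vanishes on homogeneous elements of nontrivial degree. -/
lemma trace_mul_odd (h2 : (2 : F) ≠ 0) (z : K10A F F) :
    LinearMap.trace F (K10A F F) (mulBilin F z ∘ₗ oddScale 1 1) = 4 * z 0 + 2 * z 1 := by
  have hc : (2 : F) * 2⁻¹ = 1 := mul_inv_cancel₀ h2
  rw [trace_eq]
  have hs (f : Fin 10 → F) :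
      ∑ i, f i = f 0 + f 1 + f 2 + f 3 + f 4 + f 5 + f 6 + f 7 + f 8 + f 9 := by
    simp [Fin.sum_univ_succ]; ring
  simp only [hs, LinearMap.comp_apply, mulBilin_apply, mul_apply, oddScale_apply, bv_apply]
  simp
  linear_combination (2 * z 1) * hc

/-- The sign operator of the decomposition `W ⊗ a ⊕ a ⊗ W` in terms of the triple product and the
skew-symmetric form on the odd part. -/
lemma oddForm_smul_sub_oddForm_smul (h2 : (2 : F) ≠ 0) {x y z : K10A F F} (hx : x ∈ odd F F F)
    (hy : y ∈ odd F F F) (hz : z ∈ odd F F F) :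
    oddForm F (oddScale 1 (-1) y) z • oddScale 1 (-1) x
      - oddForm F (oddScale 1 (-1) x) z • oddScale 1 (-1) y
    = oddForm F y z • x - oddForm F x z • y + (2 * oddForm F x y) • z
      - (16 : F) • ((x * y) * z) := by
  have hc : (2 : F) * 2⁻¹ = 1 := mul_inv_cancel₀ h2
  rw [mem_odd_iff] at hx hy hz
  rw [← hx, ← hy, ← hz]
  generalize (2 : F)⁻¹ = c at *
  apply ext_coord <;>
    simp only [sub_apply, add_apply, smul_apply, smul_eq_mul, mul_apply, oddForm_apply, oddScale_apply]
  all_goals clear hx hy hz; grind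

section Graded

variable {G : Type} [CommGroup G] {Γ : G → Submodule F (K10A F F)}

lemma iSupIndep_of_grading (hΓ : IsSuperGrading (even F F F) (odd F F F) Γ) : iSupIndep Γ :=
  letI := Classical.decEq G
  DirectSum.IsInternal.submodule_iSupIndep hΓ.1

lemma iSup_eq_top_of_grading (hΓ : IsSuperGrading (even F F F) (odd F F F) Γ) :
    ⨆ g, Γ g = ⊤ :=
  letI := Classical.decEq G
  DirectSum.IsInternal.submodule_iSup_eq_top hΓ.1

lemma oneE_mem (hΓ : IsSuperGrading (even F F F) (odd F F F) Γ) : oneE F F ∈ Γ 1 := by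
  have htop : Γ 1 ⊔ ⨆ (j) (_ : j ≠ 1), Γ j = ⊤ := by
    rw [eq_top_iff, ← iSup_eq_top_of_grading hΓ]
    refine iSup_le fun k => ?_
    by_cases hk : k = 1
    · exact hk ▸ le_sup_left
    · exact le_sup_of_le_right (le_iSup₂_of_le k hk le_rfl)
  obtain ⟨p, hp, q, hq, hpq⟩ := Submodule.mem_sup.1 (htop ▸ Submodule.mem_top : oneE F F ∈ _)
  have key : (⊤ : Submodule F (K10A F F)) ≤ LinearMap.ker ((mulBilin F).flip q) := by
    rw [← iSup_eq_top_of_grading hΓ]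
    refine iSup_le fun g x hx => ?_
    have hxp : x * p ∈ Γ g := by simpa using hΓ.2.1 g 1 x p hx hp
    have hsum : x * p + x * q = x := by
      rw [← mulBilin_apply, ← mulBilin_apply, ← map_add, hpq, mulBilin_apply, mul_oneE]
    have hxq : x * q ∈ Γ g := by
      rw [eq_sub_of_add_eq' hsum]
      exact (Γ g).sub_mem hx hxp
    have hle : ⨆ (j) (_ : j ≠ 1), Γ j ≤
        (⨆ (j) (_ : j ≠ g), Γ j).comap (mulBilin F x) :=
      iSup₂_le fun j hj y hy =>
        Submodule.mem_iSup_of_mem (g * j) (Submodule.mem_iSup_of_mem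
          (by simpa using hj) (hΓ.2.1 g j x y hx hy))
    exact Submodule.disjoint_def.1 (iSupIndep_of_grading hΓ g) _ hxq (hle hq)
  have hq0 : q = 0 := by
    have : oneE F F * q = 0 := key Submodule.mem_top
    rwa [oneE_mul] at this
  rw [← hpq, hq0, add_zero]
  exact hp

lemma oddPart_mem (hΓ : IsSuperGrading (even F F F) (odd F F F) Γ) {g : G} {x : K10A F F}
    (hx : x ∈ Γ g) : oddScale 1 1 x ∈ Γ g := by
  rw [hΓ.2.2 g] at hx
  obtain ⟨y, hy, z, hz, rfl⟩ := Submodule.mem_sup.1 hx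
  rw [map_add, oddScale_of_mem_even hy.2, mem_odd_iff.1 hz.2, zero_add]
  exact hz.1

lemma mul_eq_one_of_oddForm_ne_zero (h2 : (2 : F) ≠ 0)
    (hΓ : IsSuperGrading (even F F F) (odd F F F) Γ) {g h : G} {x y : K10A F F}
    (hx : x ∈ Γ g) (hy : y ∈ Γ h) (hxo : x ∈ odd F F F) (hyo : y ∈ odd F F F)
    (hxy : oddForm F x y ≠ 0) : g * h = 1 := by
  by_contra hne
  have hc : (2 : F) * 2⁻¹ = 1 := mul_inv_cancel₀ h2
  letI := Classical.decEq G
  have htr := LinearMap.trace_eq_zero_of_mapsTo_ne hΓ.1 (fun k => g * h * k)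
    (fun k hk => hne (by simpa using hk)) (f := mulBilin F (x * y) ∘ₗ oddScale 1 1)
    (fun k z hz => hΓ.2.1 _ _ _ _ (hΓ.2.1 _ _ _ _ hx hy) (oddPart_mem hΓ hz))
  rw [trace_mul_odd h2] at htr
  rw [mem_odd_iff] at hxo hyo
  rw [← hxo, ← hyo] at htr
  simp only [mul_apply, oddScale_apply] at htr
  rw [oddForm_apply] at hxy
  refine hxy ?_
  generalize (2 : F)⁻¹ = c at *
  grind

/-- The odd form is nondegenerate, so it is detected on homogeneous odd elements. -/
lemma exists_homogeneous (hΓ : IsSuperGrading (even F F F) (odd F F F) Γ) {x : K10A F F}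
    (hx : x ∈ odd F F F) (hx0 : x ≠ 0) :
    ∃ g, ∃ y ∈ Γ g, y ∈ odd F F F ∧ oddForm F x y ≠ 0 := by
  by_contra! hcon
  have key : (⊤ : Submodule F (K10A F F)) ≤ LinearMap.ker (oddForm F x) := by
    rw [← iSup_eq_top_of_grading hΓ]
    refine iSup_le fun g y hy => ?_
    have := hcon g _ (oddPart_mem hΓ hy) (oddScale_mem_odd 1 1 y)
    rwa [← oddForm_oddScale, mem_odd_iff.1 hx] at this
  have hv (y : K10A F F) : oddForm F x y = 0 := key Submodule.mem_top
  have h6 := hv (bv F 6)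
  have h7 := hv (bv F 7)
  have h8 := hv (bv F 8)
  have h9 := hv (bv F 9)
  simp [oddForm_apply, bv_apply] at h6 h7 h8 h9
  refine hx0 ?_
  rw [← mem_odd_iff.1 hx]
  apply ext_coord <;> simp [oddScale_apply, *]

lemma triple_mem (h2 : (2 : F) ≠ 0) (hΓ : IsSuperGrading (even F F F) (odd F F F) Γ)
    {g h k : G} {x y z : K10A F F} (hx : x ∈ Γ g) (hy : y ∈ Γ h) (hz : z ∈ Γ k)
    (hxo : x ∈ odd F F F) (hyo : y ∈ odd F F F) (hzo : z ∈ odd F F F) :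
    oddForm F (oddScale 1 (-1) y) z • oddScale 1 (-1) x
      - oddForm F (oddScale 1 (-1) x) z • oddScale 1 (-1) y ∈ Γ (g * h * k) := by
  have aux {g h k : G} {x y z : K10A F F} (hx : x ∈ Γ g) (hy : y ∈ Γ h) (hz : z ∈ Γ k)
      (hxo : x ∈ odd F F F) (hyo : y ∈ odd F F F) : oddForm F x y • z ∈ Γ (g * h * k) := by
    by_cases h0 : oddForm F x y = 0
    · rw [h0, zero_smul]; exact zero_mem _
    · rw [mul_eq_one_of_oddForm_ne_zero h2 hΓ hx hy hxo hyo h0, one_mul]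
      exact Submodule.smul_mem _ _ hz
  rw [oddForm_smul_sub_oddForm_smul h2 hxo hyo hzo]
  refine sub_mem (add_mem (sub_mem ?_ ?_) ?_) (Submodule.smul_mem _ _
    (hΓ.2.1 _ _ _ _ (hΓ.2.1 _ _ _ _ hx hy) hz))
  · rw [show g * h * k = h * k * g by rw [mul_assoc, mul_comm]]
    exact aux hy hz hx hyo hzo
  · rw [show g * h * k = g * k * h by rw [mul_right_comm]]
    exact aux hx hz hy hxo hzo
  · rw [mul_smul]
    exact Submodule.smul_mem _ _ (aux hx hy hz hxo hyo)

end Graded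

/-- The action of a pair of `2 × 2` matrices `(p, r; q, s)`, `(p', r'; q', s')` on `K₁₀`. -/
def pairFun (p q r s p' q' r' s' : F) (x : K10A F F) : K10A F F :=
  ![x 0, x 1,
    x 2 * p * p' + x 3 * p * r' + x 4 * r * p' + x 5 * r * r',
    x 2 * p * q' + x 3 * p * s' + x 4 * r * q' + x 5 * r * s',
    x 2 * q * p' + x 3 * q * r' + x 4 * s * p' + x 5 * s * r',
    x 2 * q * q' + x 3 * q * s' + x 4 * s * q' + x 5 * s * s',
    x 6 * p + x 7 * r, x 6 * q + x 7 * s, x 8 * p' + x 9 * r', x 8 * q' + x 9 * s']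

lemma pairFun_apply (p q r s p' q' r' s' : F) (x : K10A F F) :
    pairFun p q r s p' q' r' s' x 0 = x 0 ∧ pairFun p q r s p' q' r' s' x 1 = x 1 ∧
    pairFun p q r s p' q' r' s' x 2 =
      x 2 * p * p' + x 3 * p * r' + x 4 * r * p' + x 5 * r * r' ∧
    pairFun p q r s p' q' r' s' x 3 =
      x 2 * p * q' + x 3 * p * s' + x 4 * r * q' + x 5 * r * s' ∧
    pairFun p q r s p' q' r' s' x 4 =
      x 2 * q * p' + x 3 * q * r' + x 4 * s * p' + x 5 * s * r' ∧
    pairFun p q r s p' q' r' s' x 5 =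
      x 2 * q * q' + x 3 * q * s' + x 4 * s * q' + x 5 * s * s' ∧
    pairFun p q r s p' q' r' s' x 6 = x 6 * p + x 7 * r ∧
    pairFun p q r s p' q' r' s' x 7 = x 6 * q + x 7 * s ∧
    pairFun p q r s p' q' r' s' x 8 = x 8 * p' + x 9 * r' ∧
    pairFun p q r s p' q' r' s' x 9 = x 8 * q' + x 9 * s' :=
  ⟨rfl, rfl, rfl, rfl, rfl, rfl, rfl, rfl, rfl, rfl⟩

section Pair

variable {p q r s p' q' r' s' : F}

lemma pairFun_mul (h : p * s - q * r = 1) (h' : p' * s' - q' * r' = 1) (x y : K10A F F) :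
    pairFun p q r s p' q' r' s' (x * y) =
      pairFun p q r s p' q' r' s' x * pairFun p q r s p' q' r' s' y := by
  generalize hc : (2 : F)⁻¹ = c
  apply ext_coord <;> simp only [mul_apply, pairFun_apply, hc]
  all_goals clear hc
  all_goals grind

lemma pairFun_pairFun_inv (h : p * s - q * r = 1) (h' : p' * s' - q' * r' = 1) (x : K10A F F) :
    pairFun p q r s p' q' r' s' (pairFun s (-q) (-r) p s' (-q') (-r') p' x) = x := by
  apply ext_coord <;> simp only [pairFun_apply]
  all_goals grind

/-- The linear equivalence underlying `pairAut`. -/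
def pairEquiv (h : p * s - q * r = 1) (h' : p' * s' - q' * r' = 1) :
    K10A F F ≃ₗ[F] K10A F F where
  toFun := pairFun p q r s p' q' r' s'
  invFun := pairFun s (-q) (-r) p s' (-q') (-r') p'
  map_add' x y := by
    apply ext_coord <;> simp only [pairFun_apply, add_apply] <;> ring
  map_smul' c x := by
    apply ext_coord <;> simp only [pairFun_apply, smul_apply, smul_eq_mul, RingHom.id_apply] <;>
      ring
  left_inv x := by
    have := pairFun_pairFun_inv (p := s) (q := -q) (r := -r) (s := p) (p' := s') (q' := -q')
      (r' := -r') (s' := p') (by linear_combination h) (by linear_combination h') x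
    simpa only [neg_neg] using this
  right_inv := pairFun_pairFun_inv h h'

lemma pairFun_mem_even {x : K10A F F} (hx : x ∈ even F F F) :
    pairFun p q r s p' q' r' s' x ∈ even F F F := by
  have hx' : ∀ i, i ∉ ({0, 1, 2, 3, 4, 5} : Set (Fin 10)) → x i = 0 := hx
  intro i hi
  fin_cases i <;> first
    | (simp [pairFun_apply, hx' 6 (by simp), hx' 7 (by simp), hx' 8 (by simp), hx' 9 (by simp)]; done)
    | exact absurd (by simp) hi

lemma pairFun_mem_odd {x : K10A F F} (hx : x ∈ odd F F F) :
    pairFun p q r s p' q' r' s' x ∈ odd F F F := by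
  have hx' : ∀ i, i ∉ ({6, 7, 8, 9} : Set (Fin 10)) → x i = 0 := hx
  intro i hi
  fin_cases i <;> first
    | (simp [pairFun_apply, hx' 0 (by simp), hx' 1 (by simp), hx' 2 (by simp), hx' 3 (by simp),
        hx' 4 (by simp), hx' 5 (by simp)]; done)
    | exact absurd (by simp) hi

/-- The automorphism of `K₁₀` given by a pair of matrices of determinant one. -/
def pairAut (h : p * s - q * r = 1) (h' : p' * s' - q' * r' = 1) :
    SuperAut F (K10A F F) (even F F F) (odd F F F) where
  e := pairEquiv h h'
  map_mul' := pairFun_mul h h'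
  map_even := by
    refine le_antisymm (Submodule.map_le_iff_le_comap.2 fun x hx => pairFun_mem_even hx)
      fun x hx => ?_
    exact ⟨_, pairFun_mem_even hx, pairFun_pairFun_inv h h' x⟩
  map_odd := by
    refine le_antisymm (Submodule.map_le_iff_le_comap.2 fun x hx => pairFun_mem_odd hx)
      fun x hx => ?_
    exact ⟨_, pairFun_mem_odd hx, pairFun_pairFun_inv h h' x⟩

lemma pairAut_apply (h : p * s - q * r = 1) (h' : p' * s' - q' * r' = 1) (x : K10A F F) :
    (pairAut h h').e x = pairFun p q r s p' q' r' s' x := rfl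

end Pair

section Graded

variable {G : Type} [CommGroup G] {Γ : G → Submodule F (K10A F F)}

lemma gradIso_gradingOf (hΓ : IsSuperGrading (even F F F) (odd F F F) Γ)
    (ψ : SuperAut F (K10A F F) (even F F F) (odd F F F)) {n : ℕ} (w : Fin n → K10A F F)
    (d : Fin n → G) (hw : Submodule.span F (Set.range w) = ⊤) (hmem : ∀ i, ψ.e (w i) ∈ Γ (d i)) :
    GradIso (even F F F) (odd F F F) Γ (gradingOf F w d) := by
  have key (g : G) : (gradingOf F w d g).map ψ.e.toLinearMap = Γ g := by
    refine eq_of_le_of_iSup_eq_top (Δ := fun g => (gradingOf F w d g).map ψ.e.toLinearMap)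
      (iSupIndep_of_grading hΓ) (fun g => ?_) ?_ g
    · rw [Submodule.map_le_iff_le_comap]
      refine Submodule.span_le.2 ?_
      rintro _ ⟨i, hi, rfl⟩
      exact hi ▸ hmem i
    · rw [← Submodule.map_iSup, iSup_gradingOf w d hw, Submodule.map_top]
      exact LinearEquiv.range _
  refine ⟨ψ⁻¹, fun g => ?_⟩
  rw [← key g, ← Submodule.map_comp]
  have : (ψ⁻¹).e.toLinearMap ∘ₗ ψ.e.toLinearMap = LinearMap.id := by
    refine LinearMap.ext fun x => ?_
    exact congrArg (fun f : SuperAut F (K10A F F) (even F F F) (odd F F F) => f.e x)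
      (inv_mul_cancel ψ)
  rw [this, Submodule.map_id]

lemma bv_zero_eq : bv F 0 = oneE F F := by
  funext i; fin_cases i <;> rfl

lemma one_mem_of_aut (hΓ : IsSuperGrading (even F F F) (odd F F F) Γ)
    (ψ : SuperAut F (K10A F F) (even F F F) (odd F F F)) : ψ.e (bv F 0) ∈ Γ 1 := by
  have h1 : ψ.e (oneE F F) = oneE F F := by
    obtain ⟨y, hy⟩ := ψ.e.surjective (oneE F F)
    have := ψ.map_mul' (oneE F F) y
    rwa [oneE_mul, hy, mul_oneE, eq_comm] at this
  rw [bv_zero_eq, h1]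
  exact oneE_mem hΓ

lemma gradIso_gamma1 (h2 : (2 : F) ≠ 0) (hΓ : IsSuperGrading (even F F F) (odd F F F) Γ)
    (ψ : SuperAut F (K10A F F) (even F F F) (odd F F F)) {g₁ g₂ : G}
    (h6 : ψ.e (bv F 6) ∈ Γ g₁) (h7 : ψ.e (bv F 7) ∈ Γ g₁⁻¹)
    (h8 : ψ.e (bv F 8) ∈ Γ g₂) (h9 : ψ.e (bv F 9) ∈ Γ g₂⁻¹) :
    GradIso (even F F F) (odd F F F) Γ (gamma1 F g₁ g₂) := by
  have hc : (2 : F) * 2⁻¹ = 1 := mul_inv_cancel₀ h2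
  have hmul {g h : G} {x y : K10A F F} (hx : ψ.e x ∈ Γ g) (hy : ψ.e y ∈ Γ h) :
      ψ.e (x * y) ∈ Γ (g * h) := ψ.map_mul' x y ▸ hΓ.2.1 g h _ _ hx hy
  have h0 := one_mem_of_aut hΓ ψ
  have e1 : bv F 1 = bv F 6 * bv F 7 + (3 * 2⁻¹ ^ 3 : F) • bv F 0 := by
    apply ext_coord <;> simp [mul_apply, bv_apply, -inv_pow]
  have e2 : bv F 2 = (4 : F) • (bv F 6 * bv F 8) := by
    apply ext_coord <;> simp [mul_apply, bv_apply, -inv_pow]; grind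
  have e3 : bv F 3 = (4 : F) • (bv F 6 * bv F 9) := by
    apply ext_coord <;> simp [mul_apply, bv_apply, -inv_pow]; grind
  have e4 : bv F 4 = (4 : F) • (bv F 7 * bv F 8) := by
    apply ext_coord <;> simp [mul_apply, bv_apply, -inv_pow]; grind
  have e5 : bv F 5 = (4 : F) • (bv F 7 * bv F 9) := by
    apply ext_coord <;> simp [mul_apply, bv_apply, -inv_pow]; grind
  refine gradIso_gradingOf hΓ ψ _ _ span_bv fun i => ?_
  fin_cases i
  · exact h0
  · change ψ.e (bv F 1) ∈ Γ 1
    rw [e1, map_add, map_smul]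
    exact add_mem (by simpa using hmul h6 h7) (Submodule.smul_mem _ _ h0)
  · change ψ.e (bv F 2) ∈ Γ _
    rw [e2, map_smul]
    exact Submodule.smul_mem _ _ (hmul h6 h8)
  · change ψ.e (bv F 3) ∈ Γ _
    rw [e3, map_smul]
    exact Submodule.smul_mem _ _ (hmul h6 h9)
  · change ψ.e (bv F 4) ∈ Γ _
    rw [e4, map_smul]
    exact Submodule.smul_mem _ _ (hmul h7 h8)
  · change ψ.e (bv F 5) ∈ Γ _
    rw [e5, map_smul]
    exact Submodule.smul_mem _ _ (hmul h7 h9)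
  · exact h6
  · exact h7
  · exact h8
  · exact h9

lemma gradIso_gamma2 (h2 : (2 : F) ≠ 0) (hΓ : IsSuperGrading (even F F F) (odd F F F) Γ)
    (ψ : SuperAut F (K10A F F) (even F F F) (odd F F F)) {g h : G} (hh : h * h = 1)
    (h6 : ψ.e (bv F 6 + bv F 8) ∈ Γ g) (h7 : ψ.e (bv F 7 + bv F 9) ∈ Γ g⁻¹)
    (h8 : ψ.e (bv F 6 - bv F 8) ∈ Γ (g * h)) (h9 : ψ.e (bv F 7 - bv F 9) ∈ Γ (g⁻¹ * h)) :
    GradIso (even F F F) (odd F F F) Γ (gamma2 F g h) := by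
  have hc : (2 : F) * 2⁻¹ = 1 := mul_inv_cancel₀ h2
  have hmul {g h k : G} {x y : K10A F F} (hx : ψ.e x ∈ Γ g) (hy : ψ.e y ∈ Γ h)
      (hk : g * h = k) : ψ.e (x * y) ∈ Γ k := by
    subst hk
    exact ψ.map_mul' x y ▸ hΓ.2.1 g h _ _ hx hy
  have h0 := one_mem_of_aut hΓ ψ
  have d67 : g * g⁻¹ = 1 := mul_inv_cancel g
  have d89 : g * h * (g⁻¹ * h) = 1 := by rw [mul_mul_mul_comm, d67, hh, one_mul]
  have e1 : bv F 1 = (2⁻¹ ^ 2 : F) • ((bv F 6 + bv F 8) * (bv F 7 + bv F 9) +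
      (bv F 6 - bv F 8) * (bv F 7 - bv F 9)) + (3 * 2⁻¹ ^ 3 : F) • bv F 0 := by
    apply ext_coord <;> simp [mul_apply, bv_apply, -inv_pow] <;> grind
  have e2 : bv F 3 - bv F 4 = (2 : F) • ((bv F 6 + bv F 8) * (bv F 7 + bv F 9) -
      (bv F 6 - bv F 8) * (bv F 7 - bv F 9)) := by
    apply ext_coord <;> simp [mul_apply, bv_apply, -inv_pow] <;> grind
  have e3 : bv F 3 + bv F 4 = (-4 : F) • ((bv F 6 + bv F 8) * (bv F 7 - bv F 9)) := by
    apply ext_coord <;> simp [mul_apply, bv_apply, -inv_pow] <;> grind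
  have e4 : bv F 2 = (-2 : F) • ((bv F 6 + bv F 8) * (bv F 6 - bv F 8)) := by
    apply ext_coord <;> simp [mul_apply, bv_apply, -inv_pow]; grind
  have e5 : bv F 5 = (-2 : F) • ((bv F 7 + bv F 9) * (bv F 7 - bv F 9)) := by
    apply ext_coord <;> simp [mul_apply, bv_apply, -inv_pow]; grind
  refine gradIso_gradingOf hΓ ψ _ _ ?_ fun i => ?_
  · set w : Fin 10 → K10A F F := ![bv F 0, bv F 1, bv F 3 - bv F 4, bv F 3 + bv F 4, bv F 2,
      bv F 5, bv F 6 + bv F 8, bv F 7 + bv F 9, bv F 6 - bv F 8, bv F 7 - bv F 9]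
    have hw (i) : w i ∈ Submodule.span F (Set.range w) := Submodule.subset_span ⟨i, rfl⟩
    have hsum {x y : K10A F F} (hs : x + y ∈ Submodule.span F (Set.range w))
        (hd : x - y ∈ Submodule.span F (Set.range w)) :
        x ∈ Submodule.span F (Set.range w) ∧ y ∈ Submodule.span F (Set.range w) := by
      constructor
      · convert! Submodule.smul_mem _ (2⁻¹ : F) (add_mem hs hd) using 1
        rw [add_add_sub_cancel, ← two_smul F, smul_smul, inv_mul_cancel₀ h2, one_smul]
      · convert! Submodule.smul_mem _ (2⁻¹ : F) (sub_mem hs hd) using 1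
        rw [add_sub_sub_cancel, ← two_smul F, smul_smul, inv_mul_cancel₀ h2, one_smul]
    have h34 := hsum (hw 3) (hw 2)
    have h68 := hsum (hw 6) (hw 8)
    have h79 := hsum (hw 7) (hw 9)
    rw [eq_top_iff, ← span_bv, Submodule.span_le]
    rintro _ ⟨i, rfl⟩
    fin_cases i
    exacts [hw 0, hw 1, hw 4, h34.1, h34.2, hw 5, h68.1, h79.1, h68.2, h79.2]
  fin_cases i
  · exact h0
  · change ψ.e (bv F 1) ∈ Γ 1
    rw [e1, map_add, map_smul, map_smul, map_add]
    exact add_mem (Submodule.smul_mem _ _ (add_mem (hmul h6 h7 d67) (hmul h8 h9 d89)))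
      (Submodule.smul_mem _ _ h0)
  · change ψ.e (bv F 3 - bv F 4) ∈ Γ 1
    rw [e2, map_smul, map_sub]
    exact Submodule.smul_mem _ _ (sub_mem (hmul h6 h7 d67) (hmul h8 h9 d89))
  · change ψ.e (bv F 3 + bv F 4) ∈ Γ h
    rw [e3, map_smul]
    exact Submodule.smul_mem _ _ (hmul h6 h9 (mul_inv_cancel_left g h))
  · change ψ.e (bv F 2) ∈ Γ _
    rw [e4, map_smul]
    exact Submodule.smul_mem _ _ (hmul h6 h8 (mul_assoc g g h).symm)
  · change ψ.e (bv F 5) ∈ Γ _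
    rw [e5, map_smul]
    exact Submodule.smul_mem _ _ (hmul h7 h9 (mul_assoc g⁻¹ g⁻¹ h).symm)
  · exact h6
  · exact h7
  · exact h8
  · exact h9

end Graded

variable {G : Type} [CommGroup G] {Γ : G → Submodule F (K10A F F)}

lemma oddScale_sign_sign {x : K10A F F} (hx : x ∈ odd F F F) :
    oddScale 1 (-1) (oddScale 1 (-1) x) = x := by
  rw [oddScale_oddScale, one_mul, neg_one_mul, neg_neg, mem_odd_iff.1 hx]

lemma oddForm_self (α β : F) (x : K10A F F) : oddForm F (oddScale α β x) x = 0 := by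
  simp only [oddForm_apply, oddScale_apply]; ring

lemma oddForm_swap (x y : K10A F F) : oddForm F x y = -oddForm F y x := by
  simp only [oddForm_apply]; ring

lemma oddScale_sign_mem (h2 : (2 : F) ≠ 0) (hΓ : IsSuperGrading (even F F F) (odd F F F) Γ)
    {g h : G} {x y : K10A F F} (hx : x ∈ Γ g) (hy : y ∈ Γ h) (hxo : x ∈ odd F F F)
    (hyo : y ∈ odd F F F) (hxy : oddForm F (oddScale 1 (-1) x) y ≠ 0) :
    oddScale 1 (-1) x ∈ Γ (g * h * g) := by
  have hmem := triple_mem h2 hΓ hx hy hx hxo hyo hxo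
  rw [oddForm_self, zero_smul, sub_zero, oddForm_oddScale, oddForm_swap] at hmem
  exact (Submodule.smul_mem_iff _ (neg_ne_zero.2 hxy)).1 hmem

lemma exists_symplectic_pair (h2 : (2 : F) ≠ 0)
    (hΓ : IsSuperGrading (even F F F) (odd F F F) Γ) {α β : F} (hα : α * α = α)
    (hβ : β * β = β) (hpres : ∀ g, ∀ x ∈ Γ g, oddScale α β x ∈ Γ g) {e : K10A F F}
    (he : oddScale α β e = e) (he0 : e ≠ 0) :
    ∃ g, ∃ u ∈ Γ g, ∃ v ∈ Γ g⁻¹, oddScale α β u = u ∧ oddScale α β v = v ∧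
      oddForm F u v = 1 := by
  have hidem (x : K10A F F) : oddScale α β (oddScale α β x) = oddScale α β x := by
    rw [oddScale_oddScale, hα, hβ]
  obtain ⟨g, y, hy, -, hey⟩ := exists_homogeneous hΓ (he ▸ oddScale_mem_odd α β e) he0
  have hu0 : oddScale α β y ≠ 0 := by
    intro h0
    rw [← he, oddForm_oddScale, h0, map_zero] at hey
    exact hey rfl
  obtain ⟨h, z, hz, hzo, hyz⟩ := exists_homogeneous hΓ (oddScale_mem_odd α β y) hu0
  have hgh := mul_eq_one_of_oddForm_ne_zero h2 hΓ (hpres g y hy) hz (oddScale_mem_odd _ _ _) hzo hyz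
  refine ⟨g, _, hpres g y hy, (oddForm F (oddScale α β y) z)⁻¹ • oddScale α β z, ?_, hidem y,
    ?_, ?_⟩
  · rw [← eq_inv_of_mul_eq_one_right hgh]
    exact Submodule.smul_mem _ _ (hpres h z hz)
  · rw [map_smul, hidem]
  · rw [map_smul, ← oddForm_oddScale, hidem, smul_eq_mul, inv_mul_cancel₀ hyz]

lemma exists_gradIso_gamma1 (h2 : (2 : F) ≠ 0)
    (hΓ : IsSuperGrading (even F F F) (odd F F F) Γ)
    (hpres : ∀ g, ∀ x ∈ Γ g, oddScale 1 (-1) x ∈ Γ g) :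
    ∃ g₁ g₂ : G, GradIso (even F F F) (odd F F F) Γ (gamma1 F g₁ g₂) := by
  have hc : (2 : F)⁻¹ * 2 = 1 := inv_mul_cancel₀ h2
  have hleft (g) (x) (hx : x ∈ Γ g) : oddScale 1 0 x ∈ Γ g := by
    have : oddScale 1 0 x = (2⁻¹ : F) • (oddScale 1 1 x + oddScale 1 (-1) x) := by
      apply ext_coord <;> simp only [smul_apply, add_apply, oddScale_apply, smul_eq_mul] <;> grind
    rw [this]
    exact Submodule.smul_mem _ _ (add_mem (oddPart_mem hΓ hx) (hpres g x hx))
  have hright (g) (x) (hx : x ∈ Γ g) : oddScale 0 1 x ∈ Γ g := by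
    have : oddScale 0 1 x = (2⁻¹ : F) • (oddScale 1 1 x - oddScale 1 (-1) x) := by
      apply ext_coord <;> simp only [smul_apply, sub_apply, oddScale_apply, smul_eq_mul] <;> grind
    rw [this]
    exact Submodule.smul_mem _ _ (sub_mem (oddPart_mem hΓ hx) (hpres g x hx))
  have hne (i : Fin 10) : bv F i ≠ 0 := fun h => by
    simpa [bv_apply] using congrFun h i
  obtain ⟨g₁, u₁, hu₁, v₁, hv₁, pu₁, pv₁, h₁⟩ := exists_symplectic_pair h2 hΓ (one_mul 1)
    (zero_mul 0) hleft (e := bv F 6) (by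
      apply ext_coord <;> simp [oddScale_apply, bv_apply]) (hne 6)
  obtain ⟨g₂, u₂, hu₂, v₂, hv₂, pu₂, pv₂, h₂⟩ := exists_symplectic_pair h2 hΓ (zero_mul 0)
    (one_mul 1) hright (e := bv F 8) (by
      apply ext_coord <;> simp [oddScale_apply, bv_apply]) (hne 8)
  have d₁ : u₁ 6 * v₁ 7 - u₁ 7 * v₁ 6 = 1 := by
    rw [oddForm_apply, ← pu₁] at h₁
    simpa [oddScale_apply] using h₁
  have d₂ : u₂ 8 * v₂ 9 - u₂ 9 * v₂ 8 = 1 := by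
    rw [oddForm_apply, ← pu₂] at h₂
    simpa [oddScale_apply] using h₂
  refine ⟨g₁, g₂, gradIso_gamma1 h2 hΓ (pairAut d₁ d₂) ?_ ?_ ?_ ?_⟩
  · convert! hu₁ using 1
    refine Eq.trans ?_ pu₁
    apply ext_coord <;> simp [pairAut_apply, pairFun_apply, bv_apply, oddScale_apply]
  · convert! hv₁ using 1
    refine Eq.trans ?_ pv₁
    apply ext_coord <;> simp [pairAut_apply, pairFun_apply, bv_apply, oddScale_apply]
  · convert! hu₂ using 1
    refine Eq.trans ?_ pu₂
    apply ext_coord <;> simp [pairAut_apply, pairFun_apply, bv_apply, oddScale_apply]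
  · convert! hv₂ using 1
    refine Eq.trans ?_ pv₂
    apply ext_coord <;> simp [pairAut_apply, pairFun_apply, bv_apply, oddScale_apply]

lemma exists_gradIso_gamma2 (h2 : (2 : F) ≠ 0)
    (hΓ : IsSuperGrading (even F F F) (odd F F F) Γ) {g : G} {x : K10A F F} (hx : x ∈ Γ g)
    (hxo : x ∈ odd F F F) (hnot : oddScale 1 (-1) x ∉ Γ g) :
    ∃ g h : G, h * h = 1 ∧ h ≠ 1 ∧ GradIso (even F F F) (odd F F F) Γ (gamma2 F g h) := by
  have hσ0 : oddScale 1 (-1) x ≠ 0 := fun h0 => hnot (h0 ▸ zero_mem _)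
  have hx0 : x ≠ 0 := fun h0 => hσ0 (by rw [h0, map_zero])
  have hσodd (z : K10A F F) : oddScale 1 (-1) z ∈ odd F F F := oddScale_mem_odd _ _ _
  obtain ⟨k, hk⟩ : ∃ k, oddScale 1 (-1) x ∈ Γ (g * k) := by
    obtain ⟨h, y, hy, hyo, hxy⟩ := exists_homogeneous hΓ (hσodd x) hσ0
    exact ⟨h * g, mul_assoc g h g ▸ oddScale_sign_mem h2 hΓ hx hy hxo hyo hxy⟩
  have hk1 : k ≠ 1 := fun h1 => hnot (by simpa [h1] using hk)
  obtain ⟨h, z, hz, hzo, hxz⟩ := exists_homogeneous hΓ hxo hx0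
  obtain rfl := eq_inv_of_mul_eq_one_right
    (mul_eq_one_of_oddForm_ne_zero h2 hΓ hx hz hxo hzo hxz)
  obtain ⟨y, hy, hyo, hxy⟩ : ∃ y ∈ Γ g⁻¹, y ∈ odd F F F ∧ oddForm F x y = 2 :=
    ⟨(2 * (oddForm F x z)⁻¹) • z, Submodule.smul_mem _ _ hz, Submodule.smul_mem _ _ hzo, by
      rw [map_smul, smul_eq_mul, mul_assoc, inv_mul_cancel₀ hxz, mul_one]⟩
  have hσxy : oddForm F (oddScale 1 (-1) x) y = 0 := by
    by_contra hne
    have := mul_eq_one_of_oddForm_ne_zero h2 hΓ hk hy (hσodd x) hyo hne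
    exact hk1 (by simpa [mul_right_comm] using this)
  have hσσ : oddForm F (oddScale 1 (-1) x) (oddScale 1 (-1) y) = 2 := by
    rw [← oddForm_oddScale, oddScale_sign_sign hxo, hxy]
  have hσy : oddScale 1 (-1) y ∈ Γ (g⁻¹ * k) := by
    have hne : oddForm F (oddScale 1 (-1) y) (oddScale 1 (-1) x) ≠ 0 := by
      rw [oddForm_swap, hσσ]; exact neg_ne_zero.2 h2
    convert! oddScale_sign_mem h2 hΓ hy hk hyo (hσodd x) hne using 2
    rw [inv_mul_cancel_left, mul_comm]
  have hkk : k * k = 1 := by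
    have := mul_eq_one_of_oddForm_ne_zero h2 hΓ hk hσy (hσodd x) (hσodd y) (by rwa [hσσ])
    rwa [mul_mul_mul_comm, mul_inv_cancel, one_mul] at this
  rw [oddForm_apply] at hxy hσxy
  simp only [oddScale_apply] at hσxy
  have d₁ : x 6 * y 7 - x 7 * y 6 = 1 :=
    mul_left_cancel₀ h2 (by linear_combination hxy + hσxy)
  have d₂ : x 8 * y 9 - x 9 * y 8 = 1 :=
    mul_left_cancel₀ h2 (by linear_combination hxy - hσxy)
  refine ⟨g, k, hkk, hk1, gradIso_gamma2 h2 hΓ (pairAut d₁ d₂) hkk ?_ ?_ ?_ ?_⟩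
  · convert! hx using 1
    refine Eq.trans ?_ (mem_odd_iff.1 hxo)
    apply ext_coord <;> simp [pairAut_apply, pairFun_apply, bv_apply, oddScale_apply]
  · convert! hy using 1
    refine Eq.trans ?_ (mem_odd_iff.1 hyo)
    apply ext_coord <;> simp [pairAut_apply, pairFun_apply, bv_apply, oddScale_apply]
  · convert! hk using 1
    apply ext_coord <;> simp [pairAut_apply, pairFun_apply, bv_apply, oddScale_apply]
  · convert! hσy using 1
    apply ext_coord <;> simp [pairAut_apply, pairFun_apply, bv_apply, oddScale_apply]

end K10A

end Kac

/-! ### STATEMENT 17 -/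

open Kac in
/-- Every grading of `K₁₀` (realized as `K10A F F`) by an abelian group `G` is
isomorphic to `Γ¹_{K₁₀}(G; g₁, g₂)` for some `g₁ g₂`, or to
`Γ²_{K₁₀}(G; g, h)` for some `g, h` with `h² = e ≠ h`. -/
theorem gradings_on_K10 (F : Type) [Field F] (hchar : (2 : F) ≠ 0)
    (G : Type) [CommGroup G] (Γ : G → Submodule F (K10A F F))
    (hΓ : IsSuperGrading (K10A.even F F F) (K10A.odd F F F) Γ) :
    (∃ g1 g2 : G, GradIso (K10A.even F F F) (K10A.odd F F F) Γ (K10A.gamma1 F g1 g2)) ∨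
    (∃ g h : G, h * h = 1 ∧ h ≠ 1 ∧
      GradIso (K10A.even F F F) (K10A.odd F F F) Γ (K10A.gamma2 F g h)) := by
  by_cases hpres : ∀ g, ∀ x ∈ Γ g, K10A.oddScale 1 (-1) x ∈ Γ g
  · exact .inl (K10A.exists_gradIso_gamma1 hchar hΓ hpres)
  · push Not at hpres
    obtain ⟨g, x, hx, hnot⟩ := hpres
    refine .inr (K10A.exists_gradIso_gamma2 hchar hΓ (K10A.oddPart_mem hΓ hx)
      (K10A.oddScale_mem_odd 1 1 x) ?_)
    rwa [K10A.oddScale_oddScale, mul_one, mul_one]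
end
end
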